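/- Let G be a group such that G/Z(G) is locally finite and has finite rank r. Then G' is locally finite and the rank of G' is bounded by a function of r only. -/

import Mathlib

/-- A group has rank at most `r` if every finitely generated subgroup can be
generated by at most `r` elements. -/
def HasRankLE (G : Type*) [Group G] (r : ℕ) : Prop :=
  ∀ H : Subgroup G, H.FG → ∃ S : Finset G, S.card ≤ r ∧ Subgroup.closure (S : Set G) = H

/-- A group is locally finite if every finitely generated subgroup is finite. -/
def IsLocallyFiniteGroup (G : Type*) [Group G] : Prop :=
  ∀ H : Subgroup G, H.FG → Finite H

set_option linter.all false
set_option linter.style.haveILetI false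
set_option linter.unusedVariables false

namespace RankBound

open Subgroup
open scoped commutatorElement

/-- Relative rank: every finitely generated subgroup is `r`-generated modulo `C`. -/
def RR {G : Type*} [Group G] (C : Subgroup G) (r : ℕ) : Prop :=
  ∀ H : Subgroup G, H.FG → ∃ s : Fin r → G, (∀ i, s i ∈ H) ∧ H ≤ closure (Set.range s) ⊔ C

/-- Subgroup generated by `n`-th powers. -/
def pw {G : Type*} [Group G] (n : ℕ) (H : Subgroup G) : Subgroup G :=
  closure ((fun x => x ^ n) '' (H : Set G))

/-- The Frattini-like operator. -/
def Ph {G : Type*} [Group G] (p : ℕ) (H : Subgroup G) : Subgroup G := pw p H ⊔ ⁅H, H⁆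

section basic
variable {G G' : Type*} [Group G] [Group G']

lemma pow_mem_pw {n : ℕ} {H : Subgroup G} {x : G} (hx : x ∈ H) : x ^ n ∈ pw n H :=
  subset_closure ⟨x, hx, rfl⟩

lemma pw_le_iff {n : ℕ} {H K : Subgroup G} : pw n H ≤ K ↔ ∀ x ∈ H, x ^ n ∈ K := by
  unfold pw
  rw [closure_le]
  constructor
  · intro h x hx
    exact h ⟨x, hx, rfl⟩
  · rintro h _ ⟨x, hx, rfl⟩
    exact h x hx

lemma pw_le (n : ℕ) (H : Subgroup G) : pw n H ≤ H :=
  pw_le_iff.2 fun _ hx => H.pow_mem hx n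

lemma pw_mono {n : ℕ} {H K : Subgroup G} (h : H ≤ K) : pw n H ≤ pw n K :=
  pw_le_iff.2 fun _ hx => pow_mem_pw (h hx)

lemma map_pw (f : G →* G') (n : ℕ) (H : Subgroup G) : (pw n H).map f = pw n (H.map f) := by
  unfold pw
  rw [MonoidHom.map_closure]
  congr 1
  ext x
  constructor
  · rintro ⟨_, ⟨y, hy, rfl⟩, rfl⟩
    exact ⟨f y, ⟨y, hy, rfl⟩, by simp⟩
  · rintro ⟨_, ⟨y, hy, rfl⟩, rfl⟩
    exact ⟨y ^ n, ⟨y, hy, rfl⟩, by simp⟩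

lemma normal_of_map_conj {H : Subgroup G}
    (h : ∀ g : G, H.map (MulAut.conj g).toMonoidHom ≤ H) : H.Normal :=
  ⟨fun n hn g => h g ⟨n, hn, by simp⟩⟩

lemma map_conj_of_normal {H : Subgroup G} (h : H.Normal) (g : G) :
    H.map (MulAut.conj g).toMonoidHom = H := by
  ext x
  constructor
  · rintro ⟨y, hy, rfl⟩
    simpa using h.conj_mem y hy g
  · intro hx
    refine ⟨g⁻¹ * x * g, by simpa using h.conj_mem x hx g⁻¹, by simp [mul_assoc]⟩

lemma pw_normal {n : ℕ} {H : Subgroup G} (h : H.Normal) : (pw n H).Normal :=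
  normal_of_map_conj fun g => by rw [map_pw, map_conj_of_normal h]

lemma map_Ph (f : G →* G') (p : ℕ) (H : Subgroup G) : (Ph p H).map f = Ph p (H.map f) := by
  unfold Ph
  rw [Subgroup.map_sup, map_pw, map_commutator]

lemma map_Ph_iter (f : G →* G') (p k : ℕ) (H : Subgroup G) :
    ((Ph p)^[k] H).map f = (Ph p)^[k] (H.map f) := by
  induction k generalizing H with
  | zero => rfl
  | succ k ih => rw [Function.iterate_succ_apply, Function.iterate_succ_apply, ih, map_Ph]

lemma Ph_normal {p : ℕ} {H : Subgroup G} (h : H.Normal) : (Ph p H).Normal :=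
  normal_of_map_conj fun g => by rw [map_Ph, map_conj_of_normal h]

lemma Ph_iter_normal {p k : ℕ} {H : Subgroup G} (h : H.Normal) : ((Ph p)^[k] H).Normal :=
  normal_of_map_conj fun g => by rw [map_Ph_iter, map_conj_of_normal h]

lemma Ph_le (p : ℕ) (H : Subgroup G) : Ph p H ≤ H :=
  sup_le (pw_le p H) (commutator_le_self H)

lemma map_top_mk (N : Subgroup G) [N.Normal] : (⊤ : Subgroup G).map (QuotientGroup.mk' N) = ⊤ :=
  map_top_of_surjective _ (QuotientGroup.mk'_surjective N)

lemma normal_of_le_center {C : Subgroup G} (h : C ≤ center G) : C.Normal :=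
  ⟨fun n hn g => by rw [(mem_center_iff.1 (h hn) g)]; simpa using hn⟩

lemma map_le_center {C : Subgroup G} (h : C ≤ center G) (f : G →* G')
    (hf : Function.Surjective f) : C.map f ≤ center G' := by
  rintro _ ⟨c, hc, rfl⟩
  rw [mem_center_iff]
  intro g
  obtain ⟨g, rfl⟩ := hf g
  rw [← map_mul, ← map_mul, mem_center_iff.1 (h hc) g]

lemma subgroupOf_le_center {C : Subgroup G} (h : C ≤ center G) (K : Subgroup G) :
    C.subgroupOf K ≤ center K := by
  intro c hc
  rw [mem_center_iff]
  intro g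
  exact Subtype.ext (mem_center_iff.1 (h hc) g)

lemma fg_map {H : Subgroup G} (hH : H.FG) (f : G →* G') : (H.map f).FG := by
  classical
  obtain ⟨S, rfl⟩ := hH
  exact ⟨S.image f, by rw [MonoidHom.map_closure]; simp⟩

lemma fg_of_fin [Finite G] (H : Subgroup G) : H.FG :=
  (Group.fg_iff_subgroup_fg H).1 inferInstance

lemma RR.mono {C D : Subgroup G} {r : ℕ} (h : RR C r) (hCD : C ≤ D) : RR D r := by
  intro H hH
  obtain ⟨s, h1, h2⟩ := h H hH
  exact ⟨s, h1, h2.trans (sup_le_sup_left hCD _)⟩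

lemma RR.map {C : Subgroup G} {r : ℕ} (h : RR C r) (f : G →* G') (hf : Function.Surjective f) :
    RR (C.map f) r := by
  classical
  intro H hH
  obtain ⟨S, rfl⟩ := hH
  choose g hg using hf
  obtain ⟨s, h1, h2⟩ := h (closure ((S.image g : Finset G) : Set G)) ⟨_, rfl⟩
  have key : (closure ((S.image g : Finset G) : Set G)).map f = closure (S : Set G') := by
    rw [MonoidHom.map_closure]
    congr 1
    ext x
    simp [hg]
  refine ⟨f ∘ s, fun i => ?_, ?_⟩
  · rw [← key]
    exact ⟨_, h1 i, rfl⟩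
  · rw [← key]
    refine (Subgroup.map_mono h2).trans ?_
    rw [Subgroup.map_sup, MonoidHom.map_closure, Set.range_comp]

lemma RR.subgroupOf {C : Subgroup G} {r : ℕ} (h : RR C r) (hC : C ≤ center G) (K : Subgroup G) :
    RR (C.subgroupOf K) r := by
  intro H hH
  obtain ⟨s, h1, h2⟩ := h (H.map K.subtype) (fg_map hH _)
  have h1' : ∀ i, ∃ t : K, t ∈ H ∧ (t : G) = s i := fun i => by
    obtain ⟨t, ht, hts⟩ := h1 i
    exact ⟨t, ht, hts⟩
  choose t ht hts using h1'
  refine ⟨t, ht, fun x hx => ?_⟩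
  haveI := normal_of_le_center hC
  have hx' := h2 ⟨x, hx, rfl⟩
  rw [mem_sup_of_normal_right] at hx'
  obtain ⟨y, hy, c, hc, hyc⟩ := hx'
  have key : (closure (Set.range t)).map K.subtype = closure (Set.range s) := by
    rw [MonoidHom.map_closure, ← Set.range_comp]
    congr 2
    ext i
    exact hts i
  rw [← key] at hy
  obtain ⟨y, hy, rfl⟩ := hy
  have : x = y * (y⁻¹ * x) := by group
  rw [this]
  refine mul_mem_sup hy ?_
  rw [mem_subgroupOf]
  have : ((y⁻¹ * x : K) : G) = c := by
    rw [coe_mul, coe_inv, inv_mul_eq_iff_eq_mul]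
    exact hyc.symm
  rw [this]
  exact hc

lemma card_dvd_of_gen {B : Subgroup G} {n k : ℕ} (hcomm : ∀ x ∈ B, ∀ y ∈ B, x * y = y * x)
    (hn : ∀ x ∈ B, x ^ n = 1) (s : Fin k → G) (hs : B = closure (Set.range s)) :
    Nat.card B ∣ n ^ k := by
  classical
  letI : CommGroup B := { (inferInstance : Group B) with
    mul_comm := fun x y => Subtype.ext (hcomm x x.2 y y.2) }
  have hs' : B = closure ((Finset.univ.image s : Finset G) : Set G) := by
    rw [hs]; simp
  haveI : Group.FG B := (Group.fg_iff_subgroup_fg B).2 ⟨_, hs'.symm⟩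
  have h1 : Nat.card B ∣ n ^ Group.rank B :=
    card_dvd_exponent_pow_rank' B fun g => Subtype.ext (hn g g.2)
  refine h1.trans (pow_dvd_pow n ?_)
  have : ∀ s : Finset G, (h : B = closure (s : Set G)) → Group.rank B ≤ s.card := by
    intro s h
    subst h
    exact Subgroup.rank_closure_finset_le_card s
  refine (this _ hs').trans (Finset.card_image_le.trans (by simp))

lemma relIndex_dvd_of_gen {H N : Subgroup G} [N.Normal] {n k : ℕ} 
    (hcomm : ⁅H, H⁆ ≤ N) (hn : ∀ x ∈ H, x ^ n ∈ N)
    (s : Fin k → G) (hsH : ∀ i, s i ∈ H) (hs : H ≤ closure (Set.range s) ⊔ N) :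
    N.relIndex H ∣ n ^ k := by
  have h1 := relIndex_ker (QuotientGroup.mk' N) (K := H)
  rw [QuotientGroup.ker_mk'] at h1
  rw [h1]
  refine card_dvd_of_gen ?_ ?_ (QuotientGroup.mk' N ∘ s) ?_
  · rintro _ ⟨x, hx, rfl⟩ _ ⟨y, hy, rfl⟩
    rw [← commutatorElement_eq_one_iff_mul_comm, ← map_commutatorElement]
    exact (QuotientGroup.eq_one_iff _).2 (hcomm (commutator_mem_commutator hx hy))
  · rintro _ ⟨x, hx, rfl⟩
    rw [← map_pow]
    exact (QuotientGroup.eq_one_iff _).2 (hn x hx)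
  · rw [Set.range_comp, ← MonoidHom.map_closure]
    apply le_antisymm
    · refine (Subgroup.map_mono hs).trans ?_
      rw [Subgroup.map_sup]
      refine sup_le le_rfl ?_
      rintro _ ⟨x, hx, rfl⟩
      rw [show QuotientGroup.mk' N x = 1 from (QuotientGroup.eq_one_iff _).2 hx]
      exact one_mem _
    · refine Subgroup.map_mono ?_
      rw [closure_le]
      rintro _ ⟨i, rfl⟩
      exact hsH i

end basic

section pgroup
variable {p : ℕ} [hp : Fact p.Prime]

lemma nil_absorb {P : Type*} [Group P] [Group.IsNilpotent P] {K L : Subgroup P} (hL : L.Normal)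
    (h : K ≤ L ⊔ ⁅K, (⊤ : Subgroup P)⁆) : K ≤ L := by
  obtain ⟨n, hn⟩ := Subgroup.nilpotent_iff_lowerCentralSeries.1 (inferInstance : Group.IsNilpotent P)
  have key : ∀ n, K ≤ L ⊔ Subgroup.lowerCentralSeries (⊤ : Subgroup P) n := by
    intro n
    induction n with
    | zero => simp
    | succ n ih =>
      refine h.trans (sup_le le_sup_left ?_)
      refine (commutator_mono ih le_rfl).trans ?_
      rw [commutator_le]
      intro g hg y _
      rw [mem_sup_of_normal_right] at hg
      obtain ⟨a, ha, b, hb, rfl⟩ := hg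
      have : ⁅a * b, y⁆ = (a * ⁅b, y⁆ * a⁻¹) * (a * (y * a⁻¹ * y⁻¹)) := by
        simp only [commutatorElement_def]; group
      rw [this]
      refine mul_mem (le_sup_right (α := Subgroup P) ?_) (le_sup_left (α := Subgroup P) ?_)
      · refine Subgroup.Normal.conj_mem inferInstance _ ?_ a
        exact commutator_mem_commutator hb (mem_top y)
      · exact mul_mem ha (hL.conj_mem _ (inv_mem ha) y)
  have := key n
  rwa [hn, sup_bot_eq] at this

lemma exists_central {P : Type*} [Group P] [Finite P] (hP : IsPGroup p P) {M : Subgroup P}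
    (hM : M.Normal) (hne : M ≠ ⊥) : ∃ z ∈ M, z ∈ center P ∧ orderOf z = p := by
  have hpM : IsPGroup p M := hP.to_subgroup M
  haveI : Nontrivial M := (nontrivial_iff_ne_bot M).2 hne
  have dvd : p ∣ Nat.card M := by
    obtain ⟨n, hn0, hn⟩ := hpM.nontrivial_iff_card.mp inferInstance
    exact hn.symm ▸ dvd_pow_self _ (ne_of_gt hn0)
  obtain ⟨b, hb, hb1⟩ := (hP.of_equiv ConjAct.toConjAct).exists_fixed_point_of_prime_dvd_card_of_fixed_point
    M dvd (a := 1) (fun g => by simp)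
  have hbc : (b : P) ∈ center P := by
    rw [mem_center_iff]
    intro g
    have := congrArg Subtype.val (hb (ConjAct.toConjAct g))
    have h2 : g * (b : P) * g⁻¹ = b := by
      exact this
    rwa [mul_inv_eq_iff_eq_mul] at h2
  obtain ⟨k, hk⟩ := (IsPGroup.iff_orderOf.1 hP) (b : P)
  have hk0 : k ≠ 0 := by
    rintro rfl
    rw [pow_zero, orderOf_eq_one_iff] at hk
    exact hb1 (Subtype.ext hk.symm)
  obtain ⟨k, rfl⟩ := Nat.exists_eq_succ_of_ne_zero hk0
  refine ⟨(b : P) ^ p ^ k, pow_mem b.2 _, pow_mem hbc _, ?_⟩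
  rw [orderOf_pow, hk, Nat.gcd_eq_right (pow_dvd_pow p (Nat.le_succ k)), Nat.pow_div (Nat.le_succ k) hp.out.pos]
  simp

lemma commute_aux {P : Type*} [Group P] {x k l c d : P} (hc : c ∈ center P) (hd : d ∈ center P)
    (h1 : k * x * k⁻¹ = c * x) (h2 : l * x * l⁻¹ = d * x) : Commute ⁅k, l⁆ x := by
  rw [mul_inv_eq_iff_eq_mul] at h1 h2
  have hc' := mem_center_iff.1 hc
  have hd' := mem_center_iff.1 hd
  have e1 : k * l * x = c * d * x * (k * l) := by
    rw [mul_assoc, h2]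
    calc k * (d * x * l) = (k * d) * x * l := by group
      _ = d * (k * x) * l := by rw [hd']; group
      _ = d * c * x * (k * l) := by rw [h1]; group
      _ = _ := by rw [hd' c]
  have e2 : l * k * x = c * d * x * (l * k) := by
    rw [mul_assoc, h1]
    calc l * (c * x * k) = (l * c) * x * k := by group
      _ = c * (l * x) * k := by rw [hc']; group
      _ = _ := by rw [h2]; group
  have e3 : x * (l * k)⁻¹ = (l * k)⁻¹ * (c * d) * x := by
    rw [mul_inv_eq_iff_eq_mul]
    calc x = (l * k)⁻¹ * (l * k * x) := by group
      _ = _ := by rw [e2]; group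
  have hcd := mem_center_iff.1 (mul_mem hc hd)
  have : ⁅k, l⁆ = k * l * (l * k)⁻¹ := by rw [commutatorElement_def]; group
  rw [this]
  show k * l * (l * k)⁻¹ * x = x * (k * l * (l * k)⁻¹)
  have e4 : (l * k)⁻¹ * x = (c * d)⁻¹ * (x * (l * k)⁻¹) := by
    rw [e3, hcd]; group
  calc k * l * (l * k)⁻¹ * x = k * l * ((l * k)⁻¹ * x) := by group
    _ = (k * l * (c * d)⁻¹) * x * (l * k)⁻¹ := by rw [e4]; group
    _ = (c * d)⁻¹ * (k * l * x) * (l * k)⁻¹ := by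
      rw [mem_center_iff.1 (inv_mem (mul_mem hc hd))]; group
    _ = _ := by rw [e1]; group

lemma commute_pow_aux {P : Type*} [Group P] {x k c : P} (hc : c ∈ center P) {n : ℕ}
    (h1 : k * x * k⁻¹ = c * x) (h : c ^ n = 1) : Commute (k ^ n) x := by
  have : ∀ m, k ^ m * x = c ^ m * x * k ^ m := by
    intro m
    induction m with
    | zero => simp
    | succ m ih =>
      rw [mul_inv_eq_iff_eq_mul] at h1
      rw [pow_succ' k, mul_assoc, ih]
      calc k * (c ^ m * x * k ^ m) = (k * c ^ m) * x * k ^ m := by group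
        _ = c ^ m * (k * x) * k ^ m := by rw [mem_center_iff.1 (pow_mem hc m)]; group
        _ = _ := by rw [h1]; group
  have h3 := this n
  rwa [h, one_mul] at h3

lemma centralize_of_card (m : ℕ) : ∀ {P : Type*} [Group P] [Finite P], IsPGroup p P → 
    ∀ {M : Subgroup P}, M.Normal → Nat.card M ∣ p ^ m →
    (Ph p)^[m] ⊤ ≤ centralizer (M : Set P) := by
  induction m with
  | zero =>
    intro P _ _ hP M hM hcard
    have : M = ⊥ := by
      rw [← card_eq_one]; simpa using hcard
    subst this
    intro x _
    rw [mem_centralizer_iff]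
    simp
  | succ m ih =>
    intro P _ _ hP M hM hcard
    by_cases hne : M = ⊥
    · subst hne
      intro x _
      rw [mem_centralizer_iff]
      simp
    obtain ⟨z, hzM, hzc, hzp⟩ := exists_central hP hM hne
    set N := zpowers z with hN
    have hNc : N ≤ center P := by rwa [hN, zpowers_le]
    have hNM : N ≤ M := by rwa [hN, zpowers_le]
    haveI := normal_of_le_center hNc
    have hcN : Nat.card N = p := by rw [hN, Nat.card_zpowers, hzp]
    have hNp : ∀ c ∈ N, c ^ p = 1 := by
      intro c hc
      have := pow_card_eq_one' (G := N) (x := ⟨c, hc⟩)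
      rw [hcN] at this
      simpa using congrArg Subtype.val this
    have hcardq : Nat.card (M.map (QuotientGroup.mk' N)) ∣ p ^ m := by
      have h1 := relIndex_ker (QuotientGroup.mk' N) (K := M)
      rw [QuotientGroup.ker_mk'] at h1
      rw [← h1]
      have h2 := card_mul_index (N.subgroupOf M)
      rw [show (N.subgroupOf M).index = N.relIndex M from rfl,
        Nat.card_congr (subgroupOfEquivOfLe hNM).toEquiv, hcN] at h2
      rw [← h2, pow_succ'] at hcard
      exact Nat.dvd_of_mul_dvd_mul_left hp.out.pos hcard
    have key := ih (hP.to_quotient N) (hM.map _ (QuotientGroup.mk'_surjective N)) hcardq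
    have key2 : ∀ k ∈ (Ph p)^[m] (⊤ : Subgroup P), ∀ x ∈ M, ∃ c ∈ N, k * x * k⁻¹ = c * x := by
      intro k hk x hx
      refine ⟨k * x * k⁻¹ * x⁻¹, ?_, by group⟩
      rw [← map_top_mk N, ← map_Ph_iter] at key
      have h3 := mem_centralizer_iff.1 (key ⟨k, hk, rfl⟩) _ ⟨x, hx, rfl⟩
      rw [← QuotientGroup.eq_one_iff]
      have h4 : QuotientGroup.mk' N (k * x * k⁻¹ * x⁻¹) = 1 := by
        rw [map_mul, map_mul, map_mul, ← h3]
        simp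
      exact h4
    rw [Function.iterate_succ_apply']
    refine sup_le ?_ ?_
    · rw [pw_le_iff]
      intro k hk
      rw [mem_centralizer_iff]
      intro x hx
      obtain ⟨c, hc, h⟩ := key2 k hk x hx
      exact (commute_pow_aux (hNc hc) h (hNp c hc)).symm
    · rw [commutator_le]
      intro k hk l hl
      rw [mem_centralizer_iff]
      intro x hx
      obtain ⟨c, hc, h⟩ := key2 k hk x hx
      obtain ⟨d, hd, h'⟩ := key2 l hl x hx
      exact (commute_aux (hNc hc) (hNc hd) h h').symm

end pgroup

section pgroup2
variable {p : ℕ} [hp : Fact p.Prime]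

lemma key_central {r : ℕ} {P : Type*} [Group P] [Finite P] (hP : IsPGroup p P)
    (hr : RR (⊥ : Subgroup P) r) {N : Subgroup P} (hN : N.Normal)
    (hNV : N ≤ (Ph p)^[3 * r] ⊤) (hexp : ∀ x ∈ N, x ^ (p ^ 3) = 1) :
    (Ph p)^[3 * r] ⊤ ≤ centralizer (N : Set P) := by
  set V := (Ph p)^[3 * r] (⊤ : Subgroup P) with hV
  let Q : Subgroup P → Prop := fun M => M ≤ N ∧ M.Normal ∧ ∀ x ∈ M, ∀ y ∈ M, x * y = y * x
  have h0 : Q ⊥ := by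
    refine ⟨bot_le, inferInstance, ?_⟩
    intro x hx y hy
    rw [mem_bot] at hx hy
    rw [hx, hy]
  obtain ⟨M, -, hM⟩ := (Set.toFinite {M | Q M}).exists_le_maximal h0
  obtain ⟨hMN, hMn, hMc⟩ := hM.prop
  have hcard : Nat.card M ∣ p ^ (3 * r) := by
    obtain ⟨s, hs1, hs2⟩ := hr M (fg_of_fin M)
    rw [pow_mul]
    refine card_dvd_of_gen hMc (fun x hx => hexp x (hMN hx)) s (le_antisymm (by simpa using hs2) ?_)
    rw [closure_le]
    rintro _ ⟨i, rfl⟩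
    exact hs1 i
  have hVM : V ≤ centralizer (M : Set P) := centralize_of_card (3 * r) hP hMn hcard
  suffices h : N ≤ M by
    have : M = N := le_antisymm hMN h
    rwa [this] at hVM
  by_contra hNM
  have hne : N.map (QuotientGroup.mk' M) ≠ ⊥ := by
    rw [Ne, Subgroup.map_eq_bot_iff, QuotientGroup.ker_mk']
    exact hNM
  obtain ⟨z, ⟨x, hxN, rfl⟩, hzc, hzp⟩ := exists_central (hP.to_quotient M)
    (hN.map _ (QuotientGroup.mk'_surjective M)) hne
  have hxM : x ∉ M := by
    intro hx
    rw [show QuotientGroup.mk' M x = 1 from (QuotientGroup.eq_one_iff _).2 hx, orderOf_one] at hzp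
    exact hp.out.one_lt.ne hzp
  let L : Subgroup P := (zpowers (QuotientGroup.mk' M x)).comap (QuotientGroup.mk' M)
  have hLn : L.Normal := by
    haveI : (zpowers (QuotientGroup.mk' M x)).Normal :=
      normal_of_le_center (by rwa [zpowers_le])
    exact Subgroup.Normal.comap inferInstance _
  have hLel : ∀ g ∈ L, ∃ k : ℤ, ∃ m ∈ M, g = x ^ k * m := by
    intro g hg
    obtain ⟨k, hk⟩ := mem_zpowers_iff.1 (mem_comap.1 hg)
    refine ⟨k, (x ^ k)⁻¹ * g, ?_, by group⟩
    rw [← QuotientGroup.eq]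
    rw [← map_zpow] at hk
    exact hk
  have hxc : ∀ m ∈ M, Commute x m := fun m hm =>
    (mem_centralizer_iff.1 (hVM (hNV hxN)) m hm).symm
  have hQL : Q L := by
    refine ⟨?_, hLn, ?_⟩
    · intro g hg
      obtain ⟨k, m, hm, rfl⟩ := hLel g hg
      exact mul_mem (zpow_mem hxN k) (hMN hm)
    · intro g hg g' hg'
      obtain ⟨k, m, hm, rfl⟩ := hLel g hg
      obtain ⟨k', m', hm', rfl⟩ := hLel g' hg'
      have c1 : Commute (x ^ k) (x ^ k' * m') :=
        (Commute.zpow_zpow_self x k k').mul_right ((hxc m' hm').zpow_left k)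
      have c2 : Commute m (x ^ k' * m') :=
        (((hxc m hm).zpow_left k').symm).mul_right (hMc m hm m' hm')
      exact c1.mul_left c2
  have hML : M ≤ L := by
    intro m hm
    rw [mem_comap, show QuotientGroup.mk' M m = 1 from (QuotientGroup.eq_one_iff _).2 hm]
    exact one_mem _
  exact hxM (hM.le_of_ge hQL hML (mem_comap.2 (mem_zpowers _)))

lemma key_commutator {r : ℕ} {P : Type*} [Group P] [Finite P] (hP : IsPGroup p P)
    {C : Subgroup P} (hC : C ≤ center P) (hr : RR C r) :
    ⁅(Ph p)^[3 * r] (⊤ : Subgroup P), (Ph p)^[3 * r] ⊤⁆ ≤ pw (p ^ 3) ((Ph p)^[3 * r] ⊤) ⊔ C := by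
  set V := (Ph p)^[3 * r] (⊤ : Subgroup P) with hV
  have hVn : V.Normal := Ph_iter_normal inferInstance
  haveI := normal_of_le_center hC
  haveI := pw_normal (n := p ^ 3) hVn
  set R := pw (p ^ 3) V ⊔ C with hR
  have hVm : V.map (QuotientGroup.mk' R) = (Ph p)^[3 * r] ⊤ :=
    (map_Ph_iter _ p (3 * r) ⊤).trans (by rw [map_top_mk])
  have hrq : RR (⊥ : Subgroup (P ⧸ R)) r := by
    refine (hr.map _ (QuotientGroup.mk'_surjective R)).mono ?_
    rw [le_bot_iff, Subgroup.map_eq_bot_iff, QuotientGroup.ker_mk']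
    exact le_sup_right
  have h := key_central (hP.to_quotient R) hrq (N := V.map (QuotientGroup.mk' R))
    (hVn.map _ (QuotientGroup.mk'_surjective R)) hVm.le (by
      rintro _ ⟨x, hx, rfl⟩
      rw [← map_pow]
      exact (QuotientGroup.eq_one_iff _).2 ((le_sup_left : _ ≤ R) (pow_mem_pw hx)))
  rw [← hVm, ← commutator_eq_bot_iff_le_centralizer, ← map_commutator, Subgroup.map_eq_bot_iff,
    QuotientGroup.ker_mk'] at h
  exact h

lemma index_Ph_iter {r : ℕ} {P : Type*} [Group P] [Finite P] 
    (hr : RR (⊥ : Subgroup P) r) (k : ℕ) : ((Ph p)^[k] (⊤ : Subgroup P)).index ∣ p ^ (r * k) := by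
  induction k with
  | zero => simp
  | succ k ih =>
    rw [Function.iterate_succ_apply']
    set V := (Ph p)^[k] (⊤ : Subgroup P) with hV
    have hVn : V.Normal := Ph_iter_normal inferInstance
    haveI := Ph_normal (p := p) hVn
    rw [← relIndex_mul_index (Ph_le p V), mul_add, mul_one, pow_add, mul_comm]
    refine mul_dvd_mul ih ?_
    obtain ⟨s, hs1, hs2⟩ := hr V (fg_of_fin V)
    exact relIndex_dvd_of_gen le_sup_right (fun x hx => (le_sup_left : _ ≤ Ph p V) (pow_mem_pw hx)) s hs1
      (hs2.trans (sup_le_sup_left bot_le _))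

end pgroup2

section powerful
variable {p : ℕ} [hp : Fact p.Prime]

lemma conj_eq_comm {P : Type*} [Group P] (k x : P) : k * x * k⁻¹ = ⁅k, x⁆ * x := by
  rw [commutatorElement_def]; group

lemma le_center_iff {P : Type*} [Group P] {M : Subgroup P} :
    M ≤ center P ↔ ⁅M, (⊤ : Subgroup P)⁆ = ⊥ := by
  rw [commutator_eq_bot_iff_le_centralizer, coe_top, centralizer_univ]

lemma pow_le_center {P : Type*} [Group P] {N D : Subgroup P} {n : ℕ}
    (h : ⁅N, (⊤ : Subgroup P)⁆ ≤ D) (hD : D ≤ center P) (hn : ∀ x ∈ D, x ^ n = 1) :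
    pw n N ≤ center P := by
  rw [pw_le_iff]
  intro x hx
  rw [mem_center_iff]
  intro v
  have hc : ⁅x, v⁆ ∈ D := h (commutator_mem_commutator hx (mem_top v))
  exact (commute_pow_aux (hD hc) (conj_eq_comm x v) (hn _ hc)).symm

lemma pe_core {P : Type*} [Group P] {N : Subgroup P} (h1 : pw p (pw p (pw p N)) = ⊥)
    (h2 : ⁅N, (⊤ : Subgroup P)⁆ ≤ pw p (pw p N))
    (h3 : ⁅pw p N, (⊤ : Subgroup P)⁆ ≤ center P) : ⁅pw p N, (⊤ : Subgroup P)⁆ = ⊥ := by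
  have hL : ∀ x ∈ pw p (pw p N), x ^ p = 1 := fun x hx => by
    have := pow_mem_pw (n := p) hx
    rwa [h1, mem_bot] at this
  have hLc : pw p (pw p N) ≤ center P :=
    pow_le_center le_rfl h3 fun x hx =>
      hL x (h2 (commutator_mono (pw_le p N) le_rfl hx))
  exact le_center_iff.1 (pow_le_center h2 hLc hL)

lemma map_comm_top {P P' : Type*} [Group P] [Group P'] (f : P →* P') (hf : Function.Surjective f)
    (K : Subgroup P) : ⁅K, (⊤ : Subgroup P)⁆.map f = ⁅K.map f, (⊤ : Subgroup P')⁆ := by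
  rw [map_commutator, map_top_of_surjective f hf]

lemma map_mk_bot {P : Type*} [Group P] {R : Subgroup P} [R.Normal] {K : Subgroup P} :
    K.map (QuotientGroup.mk' R) = ⊥ ↔ K ≤ R := by
  rw [Subgroup.map_eq_bot_iff, QuotientGroup.ker_mk']

lemma pe_step {P : Type*} [Group P] [Group.IsNilpotent P] {N : Subgroup P} (hN : N.Normal)
    (h2 : ⁅N, (⊤ : Subgroup P)⁆ ≤ pw p (pw p N)) :
    ⁅pw p N, (⊤ : Subgroup P)⁆ ≤ pw p (pw p (pw p N)) := by
  haveI hM := pw_normal (n := p) hN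
  haveI hL := pw_normal (n := p) hM
  haveI hL' := pw_normal (n := p) hL
  refine nil_absorb hL' ?_
  set R := pw p (pw p (pw p N)) ⊔ ⁅⁅pw p N, (⊤ : Subgroup P)⁆, (⊤ : Subgroup P)⁆ with hR
  have hs := QuotientGroup.mk'_surjective R
  have := pe_core (p := p) (N := N.map (QuotientGroup.mk' R))
    (by rw [← map_pw, ← map_pw, ← map_pw, map_mk_bot]; exact le_sup_left)
    (by rw [← map_pw, ← map_pw, ← map_comm_top _ hs]; exact Subgroup.map_mono h2)
    (by rw [← map_pw, ← map_comm_top _ hs, le_center_iff, ← map_comm_top _ hs, map_mk_bot]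
        exact le_sup_right)
  rwa [← map_pw, ← map_comm_top _ hs, map_mk_bot] at this

lemma sq_dvd_choose : p ^ 2 ∣ (p ^ 3).choose 2 := by
  by_cases h : p = 2
  · subst h; decide
  · have h1 : p ^ 3 ∣ (p ^ 3).choose 2 * 2 := by
      have := Nat.add_one_mul_choose_eq (p ^ 3 - 1) 1
      rw [Nat.sub_add_cancel (Nat.pos_of_ne_zero (pow_ne_zero 3 hp.out.ne_zero))] at this
      exact ⟨_, this.symm⟩
    have h2 : Nat.Coprime (p ^ 3) 2 :=
      Nat.Coprime.pow_left 3 ((Nat.coprime_primes hp.out Nat.prime_two).2 h)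
    exact (pow_dvd_pow p (by norm_num)).trans (h2.dvd_of_dvd_mul_right h1)

lemma conj_pow_aux {P : Type*} [Group P] {x v c d : P} (hd : d ∈ center P)
    (h1 : x * v * x⁻¹ = c * v) (h2 : x * c * x⁻¹ = d * c) (n : ℕ) :
    x ^ n * v * (x ^ n)⁻¹ = d ^ (n.choose 2) * c ^ n * v := by
  have hd' := mem_center_iff.1 hd
  induction n with
  | zero => simp
  | succ n ih =>
    have e : Commute d c := (hd' c).symm
    have e2 : Commute d x := (hd' x).symm
    have h3 : x * c ^ n * x⁻¹ = d ^ n * c ^ n := by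
      rw [← e.mul_pow, ← h2, conj_pow]
    have h4 : x * d ^ (n.choose 2) * x⁻¹ = d ^ (n.choose 2) := by
      rw [mul_inv_eq_iff_eq_mul]; exact (e2.pow_left _).symm
    calc x ^ (n + 1) * v * (x ^ (n + 1))⁻¹ = x * (x ^ n * v * (x ^ n)⁻¹) * x⁻¹ := by
          rw [pow_succ' x]; group
      _ = (x * d ^ (n.choose 2) * x⁻¹) * (x * c ^ n * x⁻¹) * (x * v * x⁻¹) := by
          rw [ih]; group
      _ = _ := by
          rw [h4, h3, h1, Nat.choose_succ_succ' n 1, Nat.choose_one_right, add_comm n, pow_add, pow_succ c]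
          simp only [mul_assoc]

lemma pe_base_core {P : Type*} [Group P] {C : Subgroup P} (hC : C ≤ center P)
    (h0 : ⁅(⊤ : Subgroup P), (⊤ : Subgroup P)⁆ ≤ pw (p ^ 3) ⊤ ⊔ C)
    (h1 : pw p (pw p ⁅(⊤ : Subgroup P), (⊤ : Subgroup P)⁆) = ⊥)
    (h3 : ⁅⁅(⊤ : Subgroup P), (⊤ : Subgroup P)⁆, (⊤ : Subgroup P)⁆ ≤ center P) :
    ⁅⁅(⊤ : Subgroup P), (⊤ : Subgroup P)⁆, (⊤ : Subgroup P)⁆ = ⊥ := by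
  rw [← le_center_iff]
  refine h0.trans (sup_le ?_ hC)
  rw [pw_le_iff]
  intro x _
  rw [mem_center_iff]
  intro v
  have hexp : ∀ c ∈ ⁅(⊤ : Subgroup P), (⊤ : Subgroup P)⁆, c ^ (p ^ 2) = 1 := fun c hc => by
    have := pow_mem_pw (n := p) (pow_mem_pw (n := p) hc)
    rwa [h1, mem_bot, ← pow_mul, ← sq] at this
  have hc : ⁅x, v⁆ ∈ ⁅(⊤ : Subgroup P), (⊤ : Subgroup P)⁆ :=
    commutator_mem_commutator (mem_top _) (mem_top _)
  have hd : ⁅x, ⁅x, v⁆⁆ ∈ ⁅⁅(⊤ : Subgroup P), (⊤ : Subgroup P)⁆, (⊤ : Subgroup P)⁆ := by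
    rw [commutator_comm]
    exact commutator_mem_commutator (mem_top _) hc
  have key := conj_pow_aux (h3 hd) (conj_eq_comm x v) (conj_eq_comm x _) (p ^ 3)
  have e1 : ⁅x, v⁆ ^ p ^ 3 = 1 := by
    rw [pow_succ p 2, pow_mul, hexp _ hc, one_pow]
  have e2 : ⁅x, ⁅x, v⁆⁆ ^ (p ^ 3).choose 2 = 1 := by
    obtain ⟨t, ht⟩ := sq_dvd_choose (p := p)
    rw [ht, pow_mul, hexp, one_pow]
    exact commutator_mono le_top le_rfl hd
  rw [e1, e2, one_mul, one_mul, mul_inv_eq_iff_eq_mul] at key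
  exact key.symm

lemma pe_base {P : Type*} [Group P] [Group.IsNilpotent P] {C : Subgroup P} (hC : C ≤ center P)
    (h0 : ⁅(⊤ : Subgroup P), (⊤ : Subgroup P)⁆ ≤ pw (p ^ 3) ⊤ ⊔ C) :
    ⁅⁅(⊤ : Subgroup P), (⊤ : Subgroup P)⁆, (⊤ : Subgroup P)⁆ ≤
      pw p (pw p ⁅(⊤ : Subgroup P), (⊤ : Subgroup P)⁆) := by
  haveI hM := pw_normal (n := p) (commutator_normal (⊤ : Subgroup P) (⊤ : Subgroup P))
  haveI hL := pw_normal (n := p) hM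
  refine nil_absorb hL ?_
  set W := ⁅(⊤ : Subgroup P), (⊤ : Subgroup P)⁆ with hW
  set R := pw p (pw p W) ⊔ ⁅⁅W, (⊤ : Subgroup P)⁆, (⊤ : Subgroup P)⁆ with hR
  have hs := QuotientGroup.mk'_surjective R
  have hWm : W.map (QuotientGroup.mk' R) = ⁅(⊤ : Subgroup (P ⧸ R)), (⊤ : Subgroup (P ⧸ R))⁆ :=
    (map_comm_top _ hs ⊤).trans (by rw [map_top_mk])
  have := pe_base_core (p := p) (C := C.map (QuotientGroup.mk' R)) (map_le_center hC _ hs)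
    (by rw [← hWm, ← map_top_mk R, ← map_pw, ← Subgroup.map_sup]; exact Subgroup.map_mono h0)
    (by rw [← hWm, ← map_pw, ← map_pw, map_mk_bot]; exact le_sup_left)
    (by rw [← hWm, ← map_comm_top _ hs, le_center_iff, ← map_comm_top _ hs, map_mk_bot]
        exact le_sup_right)
  rwa [← hWm, ← map_comm_top _ hs, map_mk_bot] at this

end powerful

section count
variable {p : ℕ} [hp : Fact p.Prime]

lemma card_mul_relIndex' {P : Type*} [Group P] {N H : Subgroup P} (h : N ≤ H) :
    Nat.card N * N.relIndex H = Nat.card H := by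
  have := relIndex_mul_relIndex ⊥ N H bot_le h
  rwa [relIndex_bot_left, relIndex_bot_left] at this

lemma card_sup_mul {P : Type*} [Group P] {N B : Subgroup P} [N.Normal] :
    Nat.card (N ⊔ B : Subgroup P) * Nat.card (N ⊓ B : Subgroup P) = Nat.card N * Nat.card B := by
  rw [← card_mul_relIndex' (le_sup_left : N ≤ N ⊔ B), relIndex_sup_left,
    ← card_mul_relIndex' (inf_le_right : N ⊓ B ≤ B), inf_relIndex_right]
  ring

lemma pw_lt {P : Type*} [Group P] [Finite P] (hP : IsPGroup p P) {N : Subgroup P} (hN : N ≠ ⊥) :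
    Nat.card (pw p N) < Nat.card N := by
  suffices h : ¬ N ≤ pw p N by
    have hle := pw_le p N
    refine lt_of_le_of_ne (Nat.card_le_card_of_injective _ (inclusion_injective hle)) fun he => ?_
    exact h (Subgroup.eq_of_le_of_card_ge hle he.ge).ge
  intro hle
  have hpN : IsPGroup p N := hP.to_subgroup N
  haveI : Nontrivial N := (nontrivial_iff_ne_bot N).2 hN
  obtain ⟨n, hn0, hn⟩ := hpN.nontrivial_iff_card.mp inferInstance
  obtain ⟨n, rfl⟩ := Nat.exists_eq_succ_of_ne_zero hn0.ne'
  obtain ⟨K, hK⟩ := Sylow.exists_subgroup_card_pow_prime (G := N) p (n := n)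
    (by rw [hn]; exact pow_dvd_pow p (Nat.le_succ n))
  have hidx : K.index = p := by
    have := K.card_mul_index
    rw [hK, hn, pow_succ] at this
    exact Nat.eq_of_mul_eq_mul_left (pow_pos hp.out.pos n) this
  haveI : K.Normal := normal_of_index_eq_minFac_card (by
    rw [hidx, hn, hp.out.pow_minFac (Nat.succ_ne_zero n)])
  have h1 : pw p (⊤ : Subgroup N) ≤ K := by
    rw [pw_le_iff]
    intro x _
    rw [← hidx]
    exact K.pow_index_mem x
  have h2 : (pw p (⊤ : Subgroup N)).map N.subtype = pw p N := by
    rw [map_pw, ← MonoidHom.range_eq_map, range_subtype]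
  have h3 : K = ⊤ := by
    rw [eq_top_iff]
    intro x _
    have hx : (x : P) ∈ pw p N := hle x.2
    rw [← h2] at hx
    obtain ⟨y, hy, hyx⟩ := hx
    have : y = x := Subtype.ext hyx
    exact this ▸ h1 hy
  rw [h3, index_top] at hidx
  exact hp.out.one_lt.ne hidx

lemma count_step {P : Type*} [Group P] [Finite P] {A N : Subgroup P}
    (hA : ∀ a ∈ A, a ^ p = 1) (hN : N.Normal) (h : ⁅N, (⊤ : Subgroup P)⁆ ≤ pw p (pw p N)) 
    (ih : Nat.card (A ⊓ pw p N : Subgroup P) * Nat.card (pw p (pw p N)) ≤ Nat.card (pw p N)) :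
    Nat.card (A ⊓ N : Subgroup P) * Nat.card (pw p N) ≤ Nat.card N := by
  haveI hN1 := pw_normal (n := p) hN
  haveI hN2 := pw_normal (n := p) hN1
  set N1 := pw p N with hN1d
  set N2 := pw p N1 with hN2d
  let φ : N →* P ⧸ N2 := 
    { toFun := fun x => (QuotientGroup.mk' N2 x) ^ p
      map_one' := by simp
      map_mul' := fun x y => by
        have : Commute (QuotientGroup.mk' N2 (x : P)) (QuotientGroup.mk' N2 (y : P)) := by
          rw [← commutatorElement_eq_one_iff_commute, ← map_commutatorElement]
          exact (QuotientGroup.eq_one_iff _).2 (h (commutator_mem_commutator x.2 (mem_top _)))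
        rw [coe_mul, map_mul, this.mul_pow] }
  have hker : (N1 ⊔ (A ⊓ N)).subgroupOf N ≤ φ.ker := by
    intro x hx
    rw [mem_subgroupOf, mem_sup_of_normal_left] at hx
    obtain ⟨y, hy, a, ha, hya⟩ := hx
    have hyN : y ∈ N := pw_le p N hy
    have : x = ⟨y, hyN⟩ * ⟨a, ha.2⟩ := Subtype.ext hya.symm
    rw [this]
    refine mul_mem ?_ ?_
    · show (QuotientGroup.mk' N2 y) ^ p = 1
      rw [← map_pow]
      exact (QuotientGroup.eq_one_iff _).2 (pow_mem_pw hy)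
    · show (QuotientGroup.mk' N2 a) ^ p = 1
      rw [← map_pow, hA a ha.1, map_one]
  have hrange : N1.map (QuotientGroup.mk' N2) ≤ φ.range := by
    rw [Subgroup.map_le_iff_le_comap, hN1d, pw_le_iff]
    intro x hx
    exact ⟨⟨x, hx⟩, by simp [φ]⟩
  have e1 : Nat.card φ.ker * Nat.card φ.range = Nat.card N := by
    rw [← index_ker, card_mul_index]
  have e2 : Nat.card (N1 ⊔ (A ⊓ N) : Subgroup P) ≤ Nat.card φ.ker := by
    rw [← Nat.card_congr (subgroupOfEquivOfLe (sup_le (pw_le p N) inf_le_right :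
      N1 ⊔ (A ⊓ N) ≤ N)).toEquiv]
    exact Nat.card_le_card_of_injective _ (inclusion_injective hker)
  have e3 : N2.relIndex N1 ≤ Nat.card φ.range := by
    have h1 := relIndex_ker (QuotientGroup.mk' N2) (K := N1)
    rw [QuotientGroup.ker_mk'] at h1
    rw [h1]
    exact Nat.card_le_card_of_injective _ (inclusion_injective hrange)
  have e4 := card_mul_relIndex' (pw_le p N1)
  rw [← hN2d] at e4
  have e5 := card_sup_mul (N := N1) (B := A ⊓ N)
  have e6 : N1 ⊓ (A ⊓ N) = A ⊓ N1 := by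
    apply le_antisymm
    · exact le_inf (inf_le_right.trans inf_le_left) inf_le_left
    · exact le_inf inf_le_right (le_inf inf_le_left (inf_le_right.trans (pw_le p N)))
  rw [e6] at e5
  have hb : 0 < Nat.card N1 := Nat.card_pos
  refine Nat.le_of_mul_le_mul_right ?_ hb
  calc Nat.card (A ⊓ N : Subgroup P) * Nat.card N1 * Nat.card N1
      = (Nat.card N1 * Nat.card (A ⊓ N : Subgroup P)) * (Nat.card N2 * N2.relIndex N1) := by
        rw [e4]; ring
    _ = (Nat.card (N1 ⊔ (A ⊓ N) : Subgroup P) * N2.relIndex N1) *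
        (Nat.card (A ⊓ N1 : Subgroup P) * Nat.card N2) := by rw [← e5]; ring
    _ ≤ (Nat.card φ.ker * Nat.card φ.range) * Nat.card N1 := by gcongr
    _ = _ := by rw [e1]

lemma count {P : Type*} [Group P] [Finite P] (hP : IsPGroup p P) {A : Subgroup P}
    (hA : ∀ a ∈ A, a ^ p = 1) (n : ℕ) : ∀ N : Subgroup P, Nat.card N ≤ n → N.Normal →
    ⁅N, (⊤ : Subgroup P)⁆ ≤ pw p (pw p N) →
    Nat.card (A ⊓ N : Subgroup P) * Nat.card (pw p N) ≤ Nat.card N := by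
  haveI : Group.IsNilpotent P := hP.isNilpotent
  induction n with
  | zero => 
    intro N h
    exact absurd h (by have : 0 < Nat.card N := Nat.card_pos
                       omega)
  | succ n ih =>
    intro N hcard hN h
    by_cases hne : N = ⊥
    · have h1 : pw p N = ⊥ := by rw [← le_bot_iff, ← hne]; exact pw_le p N
      rw [h1, hne]; simp
    · refine count_step hA hN h (ih _ ?_ (pw_normal hN) (pe_step hN h))
      have := pw_lt hP hne
      omega

/-- Elementary central subgroups in the derived subgroup of a group that is powerful mod centre. -/
lemma card_powerful {P : Type*} [Group P] [Finite P] (hP : IsPGroup p P) {A C : Subgroup P} {r : ℕ}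
    (hC : C ≤ center P) (hr : RR C r) (hA : ∀ a ∈ A, a ^ p = 1)
    (h0 : ⁅(⊤ : Subgroup P), (⊤ : Subgroup P)⁆ ≤ pw (p ^ 3) ⊤ ⊔ C) :
    Nat.card (A ⊓ ⁅(⊤ : Subgroup P), (⊤ : Subgroup P)⁆ : Subgroup P) ≤ p ^ (r * r) := by
  haveI : Group.IsNilpotent P := hP.isNilpotent
  have hb := pe_base (p := p) hC h0
  set W := ⁅(⊤ : Subgroup P), (⊤ : Subgroup P)⁆ with hW
  have hWn : W.Normal := commutator_normal _ _
  haveI hW1 := pw_normal (n := p) hWn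
  have hcnt := count hP hA _ W le_rfl hWn hb
  have hb1 : ⁅W, (⊤ : Subgroup P)⁆ ≤ pw p W := hb.trans (pw_le p _)
  have hidx : (pw p W).relIndex W ∣ p ^ (r * r) := by
    obtain ⟨s, hs1, hs2⟩ := hr ⊤ (fg_of_fin _)
    let t : Fin (r * r) → P := fun i =>
      ⁅s (finProdFinEquiv.symm i).1, s (finProdFinEquiv.symm i).2⁆
    have ht : ∀ i, t i ∈ W := fun i => commutator_mem_commutator (mem_top _) (mem_top _)
    refine relIndex_dvd_of_gen ((commutator_mono le_rfl le_top).trans hb1)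
      (fun x hx => pow_mem_pw hx) t ht ?_
    set D := closure (Set.range t) ⊔ pw p W with hD
    have hDW : D ≤ W := by
      refine sup_le ?_ (pw_le p W)
      rw [closure_le]
      rintro _ ⟨i, rfl⟩
      exact ht i
    haveI hDn : D.Normal := by
      refine ⟨fun d hd g => ?_⟩
      rw [conj_eq_comm]
      refine mul_mem ?_ hd
      refine (le_sup_right : pw p W ≤ D) (hb1 ?_)
      rw [commutator_comm]
      exact commutator_mem_commutator (mem_top _) (hDW hd)
    have hs := QuotientGroup.mk'_surjective D
    have hgen : (⊤ : Subgroup (P ⧸ D)) ≤ closure (Set.range (QuotientGroup.mk' D ∘ s)) ⊔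
        C.map (QuotientGroup.mk' D) := by
      rw [← map_top_mk D, Set.range_comp, ← MonoidHom.map_closure, ← Subgroup.map_sup]
      exact Subgroup.map_mono hs2
    have hCc := map_le_center hC _ hs
    have hsc : ∀ i, QuotientGroup.mk' D (s i) ∈ center (P ⧸ D) := by
      intro i
      have : (⊤ : Subgroup (P ⧸ D)) ≤ centralizer {QuotientGroup.mk' D (s i)} := by
        refine hgen.trans (sup_le ?_ (hCc.trans (center_le_centralizer _)))
        rw [closure_le]
        rintro _ ⟨j, rfl⟩
        rw [SetLike.mem_coe, mem_centralizer_singleton_iff]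
        show QuotientGroup.mk' D (s j) * QuotientGroup.mk' D (s i) = _ 
        rw [Function.comp, ← commutatorElement_eq_one_iff_mul_comm, ← map_commutatorElement]
        refine (QuotientGroup.eq_one_iff _).2 ((le_sup_left : _ ≤ D) (subset_closure ?_))
        exact ⟨finProdFinEquiv (j, i), by simp only [t, Equiv.symm_apply_apply]⟩
      rw [mem_center_iff]
      intro g
      exact mem_centralizer_singleton_iff.1 (this (mem_top g))
    have htop : (⊤ : Subgroup (P ⧸ D)) ≤ center (P ⧸ D) := by
      refine hgen.trans (sup_le ?_ hCc)
      rw [closure_le]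
      rintro _ ⟨j, rfl⟩
      exact hsc j
    have hfin := le_center_iff.1 htop
    rw [← map_top_mk D, ← map_commutator, map_mk_bot] at hfin
    exact hfin
  rw [← card_mul_relIndex' (pw_le p W), mul_comm] at hcnt
  exact (Nat.le_of_mul_le_mul_left hcnt Nat.card_pos).trans
    (Nat.le_of_dvd (pow_pos hp.out.pos _) hidx)

end count

section chain

lemma ab_tors {B : Type*} [CommGroup B] [Finite B] {p k : ℕ} (hp : 0 < p) (s : Fin k → B)
    (hs : closure (Set.range s) = ⊤) (A : Subgroup B) (hA : ∀ a ∈ A, a ^ p = 1) :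
    Nat.card A ≤ p ^ k := by
  set f : B →* B := powMonoidHom p with hf
  have h1 : f.range.relIndex ⊤ ∣ p ^ k := by
    refine relIndex_dvd_of_gen ?_ ?_ s (fun i => mem_top _) ?_
    · rw [commutator_le]
      intro a _ b _
      rw [commutatorElement_eq_one_iff_mul_comm.2 (mul_comm a b)]
      exact one_mem _
    · intro x _
      exact ⟨x, rfl⟩
    · rw [hs]; exact le_sup_left
  rw [relIndex_top_right] at h1
  have h2 : Nat.card f.ker = f.range.index := by
    have e1 := f.ker.card_mul_index
    have e2 := f.range.card_mul_index
    rw [index_ker, ← e2, mul_comm] at e1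
    exact Nat.eq_of_mul_eq_mul_left Nat.card_pos e1
  have h3 : A ≤ f.ker := fun a ha => by
    rw [MonoidHom.mem_ker]; exact hA a ha
  calc Nat.card A ≤ Nat.card f.ker := Nat.card_le_card_of_injective _ (inclusion_injective h3)
    _ = f.range.index := h2
    _ ≤ p ^ k := Nat.le_of_dvd (pow_pos hp _) h1

lemma ab_tors' {G : Type*} [Group G] [Finite G] {T : Subgroup G}
    (hcomm : ∀ x ∈ T, ∀ y ∈ T, x * y = y * x) {p k : ℕ} (hp : 0 < p) (s : Fin k → G)
    (hsT : ∀ i, s i ∈ T) (hs : T ≤ closure (Set.range s)) (A : Subgroup G) (hAT : A ≤ T)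
    (hA : ∀ a ∈ A, a ^ p = 1) : Nat.card A ≤ p ^ k := by
  letI : CommGroup T := { (inferInstance : Group T) with
    mul_comm := fun a b => Subtype.ext (hcomm a a.2 b b.2) }
  have h := ab_tors hp (fun i => (⟨s i, hsT i⟩ : T)) ?_ (A.subgroupOf T) ?_
  · rwa [Nat.card_congr (subgroupOfEquivOfLe hAT).toEquiv] at h
  · rw [eq_top_iff]
    have : (⊤ : Subgroup T).map T.subtype ≤
        (closure (Set.range fun i => (⟨s i, hsT i⟩ : T))).map T.subtype := by
      rw [MonoidHom.map_closure, ← Set.range_comp]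
      rintro _ ⟨x, _, rfl⟩
      exact hs x.2
    exact (map_le_map_iff_of_injective T.subtype_injective).1 this
  · intro a ha
    exact Subtype.ext (hA a ha)

lemma card_eq_map {G Q : Type*} [Group G] [Group Q] (f : G →* Q) (X : Subgroup G) :
    Nat.card (f.ker ⊓ X : Subgroup G) * Nat.card (X.map f) = Nat.card X := by
  rw [← card_mul_relIndex' (inf_le_right : f.ker ⊓ X ≤ X), inf_relIndex_right, relIndex_ker]

lemma step_ab {G : Type*} [Group G] [Finite G] {M C A : Subgroup G} (hM : M.Normal) {p r : ℕ}
    (hp : 0 < p) (hab : ⁅M, M⁆ = ⊥) (x : G) (hx : M ⊔ zpowers x = ⊤) (hC : C ≤ center G)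
    (hr : RR C r) (hA : ∀ a ∈ A, a ^ p = 1) :
    Nat.card (A ⊓ ⁅(⊤ : Subgroup G), (⊤ : Subgroup G)⁆ : Subgroup G) ≤ p ^ r := by
  have hcm : ∀ a ∈ M, ∀ b ∈ M, a * b = b * a := by
    intro a ha b hb
    have : ⁅a, b⁆ ∈ (⊥ : Subgroup G) := hab ▸ commutator_mem_commutator ha hb
    rw [mem_bot] at this
    exact commutatorElement_eq_one_iff_mul_comm.1 this
  have hcx : ∀ m ∈ M, x * m * x⁻¹ ∈ M := fun m hm => hM.conj_mem m hm x
  let f : M →* G := 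
    { toFun := fun m => m * (x * (m : G)⁻¹ * x⁻¹)
      map_one' := by simp
      map_mul' := by
        intro a b
        have h1 := hcm (b * (x * (b:G)⁻¹ * x⁻¹)) (M.mul_mem b.2 (hcx _ (M.inv_mem b.2)))
          (x * (a:G)⁻¹ * x⁻¹) (hcx _ (M.inv_mem a.2))
        calc ((a * b : M) : G) * (x * ((a * b : M) : G)⁻¹ * x⁻¹) 
            = a * ((b * (x * (b:G)⁻¹ * x⁻¹)) * (x * (a:G)⁻¹ * x⁻¹)) := by
              push_cast; group
          _ = _ := by rw [h1]; group }
  have hf : ∀ m : M, f m = m * (x * (m : G)⁻¹ * x⁻¹) := fun m => rfl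
  set T := f.range with hT
  have hTM : T ≤ M := by
    rintro _ ⟨m, rfl⟩
    exact M.mul_mem m.2 (hcx _ (M.inv_mem m.2))
  have hTn : T.Normal := by
    rw [← normalizer_eq_top_iff, eq_top_iff, ← hx]
    refine sup_le ?_ ?_
    · intro m hm
      rw [mem_normalizer_iff]
      intro t
      constructor
      · intro ht
        rw [hcm m hm t (hTM ht)]; simpa using ht
      · intro ht
        have := hcm m⁻¹ (M.inv_mem hm) _ (hTM ht)
        have e : t = m⁻¹ * (m * t * m⁻¹) * m := by group
        rw [e, this]; simpa [mul_assoc] using ht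
    · rw [zpowers_le]
      have key : ∀ t ∈ T, x * t * x⁻¹ ∈ T := by
        rintro _ ⟨m, rfl⟩
        refine ⟨⟨x * m * x⁻¹, hcx _ m.2⟩, ?_⟩
        rw [hf, hf]
        simp only
        group
      exact mem_normalizer_fintype key
  have hGT : ⁅(⊤ : Subgroup G), (⊤ : Subgroup G)⁆ ≤ T := by
    have hxm : ∀ m ∈ M, ⁅m, x⁆ ∈ T := fun m hm => ⟨⟨m, hm⟩, by
      rw [hf, commutatorElement_def]; simp only; group⟩
    have hcq : ∀ a b : G, ⁅a, b⁆ ∈ T ↔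
        (QuotientGroup.mk' T a) * (QuotientGroup.mk' T b) =
        (QuotientGroup.mk' T b) * (QuotientGroup.mk' T a) := by
      intro a b
      rw [← commutatorElement_eq_one_iff_mul_comm, ← map_commutatorElement]
      exact (QuotientGroup.eq_one_iff _).symm
    have hZ : ∀ y : G, (∀ m ∈ M, ⁅m, y⁆ ∈ T) → ⁅x, y⁆ ∈ T → ∀ g : G, ⁅g, y⁆ ∈ T := by
      intro y h1 h2 g
      have : (⊤ : Subgroup G) ≤ (centralizer {QuotientGroup.mk' T y}).comap (QuotientGroup.mk' T) := by
        rw [← hx]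
        refine sup_le ?_ ?_
        · intro m hm
          rw [mem_comap, mem_centralizer_singleton_iff]
          exact ((hcq _ _).1 (h1 m hm))
        · rw [zpowers_le, mem_comap, mem_centralizer_singleton_iff]
          exact ((hcq _ _).1 h2)
      have h3 := this (mem_top g)
      rw [mem_comap, mem_centralizer_singleton_iff] at h3
      exact (hcq _ _).2 h3
    rw [commutator_le]
    intro a _ b _
    have h1 : ∀ g : G, ⁅g, x⁆ ∈ T := hZ x hxm (by simp)
    have h2 : ∀ m ∈ M, ∀ g : G, ⁅g, m⁆ ∈ T := by
      intro m hm
      refine hZ m (fun n hn => ?_) ?_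
      · have : ⁅n, m⁆ = 1 := commutatorElement_eq_one_iff_mul_comm.2 (hcm n hn m hm)
        rw [this]; exact one_mem _
      · rw [hcq]; exact ((hcq _ _).1 (hxm m hm)).symm
    refine hZ b (fun m hm => ?_) ?_ a
    · rw [hcq]; exact ((hcq _ _).1 (h2 m hm b)).symm
    · rw [hcq]; exact ((hcq _ _).1 (h1 b)).symm
  obtain ⟨s, -, hs⟩ := (hr.subgroupOf hC M) ⊤ (fg_of_fin _)
  refine ab_tors' (T := T) (fun a ha b hb => hcm a (hTM ha) b (hTM hb)) hp (fun i => f (s i))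
    (fun i => ⟨_, rfl⟩) ?_ _ (inf_le_right.trans hGT) (fun a ha => hA a ha.1)
  have h4 := map_mono (f := f) hs
  rw [Subgroup.map_sup, MonoidHom.map_closure, ← Set.range_comp, ← MonoidHom.range_eq_map] at h4
  refine h4.trans (sup_le le_rfl ?_)
  rintro _ ⟨c, hc, rfl⟩
  have hcc := mem_center_iff.1 (hC hc)
  have : f c = 1 := by
    rw [hf, ← mul_assoc, ← mul_assoc]
    have := hcc x
    simp only [coe_subtype] at this
    rw [← this]; group
  rw [this]; exact one_mem _

lemma step_gen {G : Type*} [Group G] [Finite G] {M C A : Subgroup G} (hM : M.Normal) {p r : ℕ}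
    (hp : 0 < p) (x : G) (hx : M ⊔ zpowers x = ⊤) (hC : C ≤ center G)
    (hr : RR C r) (hA : ∀ a ∈ A, a ^ p = 1) :
    Nat.card (A ⊓ ⁅(⊤ : Subgroup G), (⊤ : Subgroup G)⁆ : Subgroup G) ≤
      p ^ r * Nat.card (A ⊓ ⁅M, M⁆ : Subgroup G) := by
  haveI : (⁅M, M⁆).Normal := commutator_normal _ _
  set q := QuotientGroup.mk' ⁅M, M⁆ with hq
  have hqs : Function.Surjective q := QuotientGroup.mk'_surjective _
  have h := step_ab (M := M.map q) (C := C.map q) (A := A.map q) (hM.map q hqs) hp (r := r)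
    ?_ (q x) ?_ (map_le_center hC q hqs) (hr.map q hqs) ?_
  · rw [← card_eq_map q, mul_comm]
    refine Nat.mul_le_mul (le_trans ?_ h) ?_
    · refine Nat.card_le_card_of_injective _ (inclusion_injective (?_ : _ ≤ _))
      refine le_inf (map_mono inf_le_left) ((map_mono inf_le_right).trans ?_)
      rw [map_commutator]
      exact commutator_mono le_top le_top
    · refine Nat.card_le_card_of_injective _ (inclusion_injective (?_ : _ ≤ _))
      rw [hq, QuotientGroup.ker_mk']
      exact le_inf (inf_le_right.trans inf_le_left) inf_le_left
  · rw [← map_commutator, map_mk_bot]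
  · rw [← map_top_of_surjective q hqs, ← hx, Subgroup.map_sup, MonoidHom.map_zpowers]
  · rintro _ ⟨a, ha, rfl⟩
    rw [← map_pow, hA a ha, map_one]

variable {p : ℕ} [hp : Fact p.Prime]

lemma chain {P : Type*} [Group P] [Finite P] (hP : IsPGroup p P) {C A : Subgroup P} {r : ℕ}
    (hC : C ≤ center P) (hr : RR C r) (hA : ∀ a ∈ A, a ^ p = 1) (j : ℕ) :
    ∀ U : Subgroup P, U.index = p ^ j → 
    Nat.card (A ⊓ ⁅(⊤ : Subgroup P), (⊤ : Subgroup P)⁆ : Subgroup P) ≤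
      p ^ (r * j) * Nat.card (A ⊓ ⁅U, U⁆ : Subgroup P) := by
  induction j with
  | zero =>
    intro U hU
    rw [pow_zero, index_eq_one] at hU
    subst hU
    simp
  | succ j ih =>
    intro U hU
    obtain ⟨n, hn⟩ := (hP.to_subgroup U).exists_card_eq
    have hcard := U.card_mul_index
    have hd : p ^ (n + 1) ∣ Nat.card P := by
      rw [← hcard, hn, hU, ← pow_add]
      exact pow_dvd_pow _ (by omega)
    obtain ⟨K, hK, hUK⟩ := Sylow.exists_subgroup_card_pow_succ hd hn
    have hrel : U.relIndex K = p := by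
      have := card_mul_relIndex' hUK
      rw [hn, hK, pow_succ] at this
      exact Nat.eq_of_mul_eq_mul_left (pow_pos hp.out.pos n) this
    have hKi : K.index = p ^ j := by
      have := relIndex_mul_index hUK
      rw [hrel, hU, pow_succ, mul_comm] at this
      exact Nat.eq_of_mul_eq_mul_right hp.out.pos this
    refine (ih K hKi).trans ?_
    rw [mul_add, mul_one, pow_add, mul_assoc]
    refine Nat.mul_le_mul le_rfl ?_
    have hidx : (U.subgroupOf K).index = p := hrel
    have hnorm : (U.subgroupOf K).Normal := by
      apply normal_of_index_eq_minFac_card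
      rw [hidx, hK, hp.out.pow_minFac (by omega)]
    have hne : U.subgroupOf K ≠ ⊤ := by
      intro h
      rw [h, index_top] at hidx
      exact hp.out.one_lt.ne hidx
    obtain ⟨x, hx⟩ : ∃ x, x ∉ U.subgroupOf K := by
      by_contra! h
      exact hne ((eq_top_iff' _).2 h)
    have hx' : U.subgroupOf K ⊔ zpowers x = ⊤ := by
      have h1 := relIndex_mul_index (le_sup_left : U.subgroupOf K ≤ U.subgroupOf K ⊔ zpowers x)
      rw [hidx] at h1
      rcases (Nat.dvd_prime hp.out).1 (Dvd.intro_left _ h1) with h | h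
      · exact index_eq_one.1 h
      · rw [h] at h1
        have h2 := Nat.eq_of_mul_eq_mul_right hp.out.pos (h1.trans (one_mul p).symm)
        exact absurd (relIndex_eq_one.1 h2 (mem_sup_right (mem_zpowers x))) hx
    have h := step_gen hnorm hp.out.pos x hx' (subgroupOf_le_center hC K) (hr.subgroupOf hC K)
      (A := A.subgroupOf K) (fun a ha => Subtype.ext (hA a ha))
    have hmap : ∀ M : Subgroup K, Nat.card (A.subgroupOf K ⊓ ⁅M, M⁆ : Subgroup K) =
        Nat.card (A ⊓ ⁅M.map K.subtype, M.map K.subtype⁆ : Subgroup P) := by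
      intro M
      rw [← map_commutator, ← card_map_of_injective K.subtype_injective]
      congr 2
      apply le_antisymm
      · rintro _ ⟨a, ⟨h1, h2⟩, rfl⟩
        exact ⟨h1, a, h2, rfl⟩
      · rintro _ ⟨h1, a, h2, rfl⟩
        exact ⟨a, ⟨h1, h2⟩, rfl⟩
    rw [hmap, hmap, subgroupOf_map_subtype, inf_of_le_left hUK, ← MonoidHom.range_eq_map,
      range_subtype] at h
    exact h

end chain

section pgroup
variable {p : ℕ} [hp : Fact p.Prime]

/-- The bound. -/
def FF (r : ℕ) : ℕ := r * (r * (3 * r)) + r * r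

lemma comm_sup_central {P : Type*} [Group P] {V C : Subgroup P} (hC : C ≤ center P) :
    ⁅V ⊔ C, V ⊔ C⁆ ≤ ⁅V, V⁆ := by
  haveI := normal_of_le_center hC
  rw [commutator_le]
  intro a ha b hb
  obtain ⟨v, hv, c, hc, rfl⟩ := mem_sup_of_normal_right.1 ha
  obtain ⟨w, hw, d, hd, rfl⟩ := mem_sup_of_normal_right.1 hb
  have hcc := fun g => mem_center_iff.1 (hC hc) g
  have hdd := fun g => mem_center_iff.1 (hC hd) g
  have : ⁅v * c, w * d⁆ = ⁅v, w⁆ := by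
    rw [commutatorElement_def, commutatorElement_def]
    calc v * c * (w * d) * (v * c)⁻¹ * (w * d)⁻¹ 
        = v * (c * (w * d)) * c⁻¹ * v⁻¹ * d⁻¹ * w⁻¹ := by group
      _ = v * w * (d * v⁻¹) * d⁻¹ * w⁻¹ := by rw [← hcc]; group
      _ = _ := by rw [← hdd]; group
  rw [this]
  exact commutator_mem_commutator hv hw

lemma elem_bound {P : Type*} [Group P] [Finite P] (hP : IsPGroup p P) {C A : Subgroup P} {r : ℕ}
    (hC : C ≤ center P) (hr : RR C r) (hA : ∀ a ∈ A, a ^ p = 1) :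
    Nat.card (A ⊓ ⁅(⊤ : Subgroup P), (⊤ : Subgroup P)⁆ : Subgroup P) ≤ p ^ FF r := by
  haveI := normal_of_le_center hC
  set V := (Ph p)^[3 * r] (⊤ : Subgroup P) with hV
  have hk := key_commutator hP hC hr
  rw [← hV] at hk
  set U := V ⊔ C with hU
  have hidx : U.index ∣ p ^ (r * (3 * r)) := by
    set q := QuotientGroup.mk' C with hq
    have hqs : Function.Surjective q := QuotientGroup.mk'_surjective _
    have hCb : C.map q = ⊥ := (map_mk_bot).2 le_rfl
    have h1 : RR (⊥ : Subgroup (P ⧸ C)) r := hCb ▸ hr.map q hqs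
    have h2 := index_Ph_iter (p := p) h1 (3 * r)
    have h3 : U.map q = (Ph p)^[3 * r] ⊤ := by
      rw [hU, Subgroup.map_sup, hCb, sup_bot_eq, hV, map_Ph_iter, map_top_of_surjective q hqs]
    rw [← h3] at h2
    have h4 : (U.map q).comap q = U := by
      rw [comap_map_eq, hq, QuotientGroup.ker_mk']
      exact sup_eq_left.2 le_sup_right
    rwa [← index_comap_of_surjective _ hqs, h4] at h2
  obtain ⟨j, hj, hj'⟩ := (Nat.dvd_prime_pow hp.out).1 hidx
  have h1 := chain hP hC hr hA j U hj'
  have h2 : Nat.card (A ⊓ ⁅U, U⁆ : Subgroup P) ≤ p ^ (r * r) := by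
    have h3 : ⁅(⊤ : Subgroup U), (⊤ : Subgroup U)⁆ ≤ pw (p ^ 3) ⊤ ⊔ C.subgroupOf U := by
      rw [← map_le_map_iff_of_injective U.subtype_injective, map_commutator, Subgroup.map_sup,
        map_pw, subgroupOf_map_subtype, ← MonoidHom.range_eq_map, range_subtype,
        inf_of_le_left (le_sup_right : C ≤ U)]
      exact (comm_sup_central hC).trans (hk.trans (sup_le_sup_right (pw_mono le_sup_left) _))
    have h4 := card_powerful (hP.to_subgroup U) (A := A.subgroupOf U) (subgroupOf_le_center hC U)
      (hr.subgroupOf hC U) (fun a ha => Subtype.ext (hA a ha)) h3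
    refine le_trans (le_of_eq ?_) h4
    rw [← card_map_of_injective U.subtype_injective]
    congr 2
    apply le_antisymm
    · rintro x ⟨h5, h6⟩
      have : (⁅(⊤ : Subgroup U), (⊤ : Subgroup U)⁆).map U.subtype = ⁅U, U⁆ := by
        rw [map_commutator, ← MonoidHom.range_eq_map, range_subtype]
      rw [← this] at h6
      obtain ⟨y, hy, rfl⟩ := h6
      exact ⟨y, ⟨h5, hy⟩, rfl⟩
    · rintro _ ⟨y, ⟨h5, h6⟩, rfl⟩
      refine ⟨h5, ?_⟩
      have : (⁅(⊤ : Subgroup U), (⊤ : Subgroup U)⁆).map U.subtype = ⁅U, U⁆ := by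
        rw [map_commutator, ← MonoidHom.range_eq_map, range_subtype]
      rw [← this]
      exact ⟨y, h6, rfl⟩
  calc _ ≤ _ := h1
    _ ≤ p ^ (r * (r * (3 * r))) * p ^ (r * r) := 
      Nat.mul_le_mul (Nat.pow_le_pow_right hp.out.pos (Nat.mul_le_mul le_rfl hj)) h2
    _ = _ := by rw [← pow_add]; rfl

lemma tors_le_relIndex {G : Type*} [Group G] [Finite G] {T : Subgroup G}
    (hcomm : ∀ x ∈ T, ∀ y ∈ T, x * y = y * x) {n : ℕ} (A : Subgroup G) (hAT : A ≤ T)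
    (hA : ∀ a ∈ A, a ^ n = 1) : Nat.card A ≤ (pw n T).relIndex T := by
  letI : CommGroup T := { (inferInstance : Group T) with
    mul_comm := fun a b => Subtype.ext (hcomm a a.2 b b.2) }
  set f : T →* T := powMonoidHom n with hf
  have h1 : f.range.map T.subtype = pw n T := by
    apply le_antisymm
    · rintro _ ⟨_, ⟨x, rfl⟩, rfl⟩
      exact pow_mem_pw x.2
    · rw [pw_le_iff]
      intro x hx
      exact ⟨_, ⟨⟨x, hx⟩, rfl⟩, rfl⟩
  have h2 : Nat.card (pw n T) = Nat.card f.range := by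
    rw [← h1, card_map_of_injective T.subtype_injective]
  have e1 := f.ker.card_mul_index
  rw [index_ker, ← card_mul_relIndex' (pw_le n T), h2, mul_comm] at e1
  have e2 := Nat.eq_of_mul_eq_mul_left Nat.card_pos e1
  rw [← e2, ← Nat.card_congr (subgroupOfEquivOfLe hAT).toEquiv]
  refine Nat.card_le_card_of_injective _ (inclusion_injective (?_ : _ ≤ _))
  intro a ha
  rw [MonoidHom.mem_ker]
  exact Subtype.ext (hA a ha)

lemma pgroup_bound {P : Type*} [Group P] [Finite P] (hP : IsPGroup p P) {C A : Subgroup P} {r : ℕ}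
    (hC : C ≤ center P) (hr : RR C r) (hA : ∀ a ∈ A, a ^ p = 1) 
    (hAC : A ≤ C ⊓ ⁅(⊤ : Subgroup P), (⊤ : Subgroup P)⁆) :
    Nat.card A ≤ p ^ FF r := by
  set B := C ⊓ ⁅(⊤ : Subgroup P), (⊤ : Subgroup P)⁆ with hB
  refine (tors_le_relIndex (T := B) ?_ A hAC hA).trans ?_
  · intro x hx y hy
    exact mem_center_iff.1 (hC hy.1) x
  have hN : pw p B ≤ center P := (pw_le p B).trans (inf_le_left.trans hC)
  haveI := normal_of_le_center hN
  set q := QuotientGroup.mk' (pw p B) with hq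
  have hqs : Function.Surjective q := QuotientGroup.mk'_surjective _
  have h := elem_bound (hP.of_surjective q hqs) (A := B.map q) (map_le_center hC q hqs)
    (hr.map q hqs) ?_
  · have h1 : (pw p B).relIndex B = Nat.card (B.map q) := by
      rw [← relIndex_ker, hq, QuotientGroup.ker_mk']
    rw [h1]
    rw [inf_eq_left.2] at h
    · exact h
    refine (map_mono inf_le_right).trans ?_
    rw [map_commutator]
    exact commutator_mono le_top le_top
  · rintro _ ⟨b, hb, rfl⟩
    rw [← map_pow]
    exact (QuotientGroup.eq_one_iff _).2 (pow_mem_pw hb)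

end pgroup

section finite

lemma sylow_bound {p : ℕ} [hp : Fact p.Prime] {G : Type*} [Group G] [Finite G] {C A : Subgroup G}
    {r : ℕ} (hC : C ≤ center G) (hr : RR C r) (hA : ∀ a ∈ A, a ^ p = 1) 
    (hAC : A ≤ C ⊓ ⁅(⊤ : Subgroup G), (⊤ : Subgroup G)⁆) :
    Nat.card A ≤ p ^ FF r := by
  have hAp : IsPGroup p A := fun a => ⟨1, by
    rw [pow_one]; exact Subtype.ext (hA a a.2)⟩
  obtain ⟨Q, hQ⟩ := hAp.exists_le_sylow
  have h := pgroup_bound Q.isPGroup' (A := A.subgroupOf (Q : Subgroup G))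
    (subgroupOf_le_center hC _) (hr.subgroupOf hC _) (fun a ha => Subtype.ext (hA a ha)) ?_
  · rwa [Nat.card_congr (subgroupOfEquivOfLe hQ).toEquiv] at h
  intro a ha
  refine ⟨(hAC ha).1, ?_⟩
  have hac : (a : G) ∈ center G := hC (hAC ha).1
  set ϕ : Q →* Abelianization Q := Abelianization.of with hϕ
  have h1 : MonoidHom.transfer ϕ (a : G) = 1 := by
    have := Abelianization.commutator_subset_ker (MonoidHom.transfer ϕ)
    exact this (hAC ha).2
  rw [MonoidHom.transfer_eq_pow ϕ (a : G) (by
    intro k g _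
    have h2 := mem_center_iff.1 ((center G).pow_mem hac k) g
    rw [mul_assoc, ← h2]; group)] at h1
  have h2 : (⟨(a : G) ^ (Q : Subgroup G).index, (Q : Subgroup G).pow_mem a.2 _⟩ : Q) =
      a ^ (Q : Subgroup G).index := rfl
  have h3 : (ϕ a) ^ (Q : Subgroup G).index = 1 := by
    rw [← map_pow, ← h2]; exact h1
  have h4 : (ϕ a) ^ p = 1 := by
    rw [← map_pow]
    have : a ^ p = 1 := Subtype.ext (hA a ha)
    rw [this, map_one]
  have h5 : ϕ a = 1 := by
    have := (pow_gcd_eq_one (a := ϕ a)).2 ⟨h4, h3⟩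
    rwa [(Nat.Prime.coprime_iff_not_dvd hp.out).2 Q.not_dvd_index, pow_one] at this
  have h6 : a ∈ ϕ.ker := h5
  rw [hϕ, Abelianization.ker_of] at h6
  exact h6

lemma gen_pgroup {p : ℕ} [hp : Fact p.Prime] {P : Type*} [Group P] [Finite P] (hP : IsPGroup p P)
    {k : ℕ} (hk : Nat.card P ≤ p ^ k) : ∃ s : Fin k → P, closure (Set.range s) = ⊤ := by
  have key : ∀ i : ℕ, ∃ s : Fin i → P, closure (Set.range s) = ⊤ ∨
      p ^ i ≤ Nat.card (closure (Set.range s)) := by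
    intro i
    induction i with
    | zero => exact ⟨fun _ => 1, Or.inr (by rw [pow_zero]; exact Nat.card_pos)⟩
    | succ i ih =>
      obtain ⟨s, hs⟩ := ih
      by_cases hst : closure (Set.range s) = ⊤
      · refine ⟨Fin.snoc s 1, Or.inl (eq_top_iff.2 (hst ▸ closure_mono ?_))⟩
        rintro _ ⟨j, rfl⟩
        exact ⟨j.castSucc, by simp⟩
      · obtain ⟨x, hx⟩ : ∃ x, x ∉ closure (Set.range s) := by
          by_contra! h
          exact hst ((eq_top_iff' _).2 h)
        refine ⟨Fin.snoc s x, Or.inr ?_⟩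
        have hle : closure (Set.range s) ≤ closure (Set.range (Fin.snoc s x : Fin (i + 1) → P)) := by
          refine closure_mono ?_
          rintro _ ⟨j, rfl⟩
          exact ⟨j.castSucc, by simp⟩
        set L := closure (Set.range (Fin.snoc s x : Fin (i + 1) → P)) with hL
        have hxL : x ∈ L := subset_closure ⟨Fin.last i, by simp⟩
        obtain ⟨a, ha⟩ := (hP.to_subgroup (closure (Set.range s))).exists_card_eq
        obtain ⟨b, hb⟩ := (hP.to_subgroup L).exists_card_eq
        have hlt : Nat.card (closure (Set.range s)) < Nat.card L := by
          refine lt_of_le_of_ne (Nat.card_le_card_of_injective _ (inclusion_injective hle)) 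
            fun he => ?_
          exact hx ((Subgroup.eq_of_le_of_card_ge hle he.ge).ge hxL)
        have hi := hs.resolve_left hst
        rw [ha] at hi hlt
        rw [hb] at hlt ⊢
        have h1 := (Nat.pow_le_pow_iff_right hp.out.one_lt).1 hi
        have h2 := (Nat.pow_lt_pow_iff_right hp.out.one_lt).1 hlt
        exact Nat.pow_le_pow_right hp.out.pos (by omega)
  obtain ⟨s, hs | hs⟩ := key k
  · exact ⟨s, hs⟩
  · exact ⟨s, eq_top_of_le_card _ (hk.trans hs)⟩

lemma ab_gen_p {p : ℕ} [hp : Fact p.Prime] {B : Type*} [CommGroup B] [Finite B]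
    (hB : IsPGroup p B) {k : ℕ}
    (h : ∀ A : Subgroup B, (∀ a ∈ A, a ^ p = 1) → Nat.card A ≤ p ^ k) :
    ∃ s : Fin k → B, closure (Set.range s) = ⊤ := by
  set f : B →* B := powMonoidHom p with hf
  have hk := h f.ker (fun a ha => ha)
  have h2 : Nat.card f.ker = f.range.index := by
    have e1 := f.ker.card_mul_index
    have e2 := f.range.card_mul_index
    rw [index_ker, ← e2, mul_comm] at e1
    exact Nat.eq_of_mul_eq_mul_left Nat.card_pos e1
  rw [h2] at hk
  obtain ⟨t, ht⟩ := gen_pgroup (hB.to_quotient f.range) (k := k) hk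
  choose s hs using fun i => QuotientGroup.mk'_surjective f.range (t i)
  refine ⟨s, ?_⟩
  set L := closure (Set.range s) with hL
  have hLt : L ⊔ f.range = ⊤ := by
    have h3 : L.map (QuotientGroup.mk' f.range) = ⊤ := by
      rw [hL, MonoidHom.map_closure, ← Set.range_comp, ← ht]
      congr 2
      funext i
      exact hs i
    have h4 := comap_map_eq (QuotientGroup.mk' f.range) L
    rw [h3, comap_top, QuotientGroup.ker_mk'] at h4
    exact h4.symm
  by_contra hne
  set q := QuotientGroup.mk' L with hq
  have hqs : Function.Surjective q := QuotientGroup.mk'_surjective _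
  have h5 : (⊤ : Subgroup (B ⧸ L)) ≠ ⊥ := by
    intro h6
    apply hne
    rw [← map_top_of_surjective q hqs, map_mk_bot] at h6
    exact top_le_iff.1 h6
  have h6 := pw_lt (hB.to_quotient L) h5
  have h7 : pw p (⊤ : Subgroup (B ⧸ L)) = ⊤ := by
    rw [eq_top_iff]
    intro y _
    obtain ⟨x, rfl⟩ := hqs y
    have hx : x ∈ L ⊔ f.range := by rw [hLt]; exact mem_top x
    obtain ⟨l, hl, _, ⟨b, rfl⟩, rfl⟩ := mem_sup.1 hx
    have h8 : q l = 1 := (QuotientGroup.eq_one_iff _).2 hl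
    have h9 : q (f b) = (q b) ^ p := map_pow q b p
    rw [map_mul, h8, one_mul, h9]
    exact pow_mem_pw (mem_top _)
  rw [h7] at h6
  exact lt_irrefl _ h6

lemma ab_gen {B : Type*} [CommGroup B] [Finite B] {k : ℕ}
    (h : ∀ p : ℕ, p.Prime → ∀ A : Subgroup B, (∀ a ∈ A, a ^ p = 1) → Nat.card A ≤ p ^ k) :
    ∃ s : Fin k → B, closure (Set.range s) = ⊤ := by
  have key : ∀ n : ℕ, 0 < n → ∀ H : Subgroup B, (∀ x ∈ H, x ^ n = 1) →
      ∃ s : Fin k → B, closure (Set.range s) = H := by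
    intro n
    induction n using Nat.recOnPosPrimePosCoprime with
    | zero => intro h0; exact absurd h0 (lt_irrefl _)
    | one =>
      intro _ H hH
      refine ⟨fun _ => 1, ?_⟩
      have : H = ⊥ := (eq_bot_iff_forall _).2 fun x hx => by simpa using hH x hx
      rw [this, eq_bot_iff, closure_le]
      rintro _ ⟨i, rfl⟩
      rfl
    | prime_pow p m hp hm =>
      intro _ H hH
      haveI : Fact p.Prime := ⟨hp⟩
      have hHp : IsPGroup p H := fun x => ⟨m, Subtype.ext (hH x x.2)⟩
      obtain ⟨s, hs⟩ := ab_gen_p hHp (k := k) (fun A hA => by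
        rw [← card_map_of_injective H.subtype_injective]
        refine h p hp _ ?_
        rintro _ ⟨a, ha, rfl⟩
        rw [← map_pow, hA a ha, map_one])
      refine ⟨fun i => (s i : B), ?_⟩
      have := congrArg (Subgroup.map H.subtype) hs
      rw [MonoidHom.map_closure, ← Set.range_comp, ← MonoidHom.range_eq_map, range_subtype] at this
      exact this
    | coprime a b ha hb hab iha ihb =>
      intro _ H hH
      obtain ⟨s, hs⟩ := iha (by omega) (H ⊓ (powMonoidHom a : B →* B).ker) (fun x hx => hx.2)
      obtain ⟨t, ht⟩ := ihb (by omega) (H ⊓ (powMonoidHom b : B →* B).ker) (fun x hx => hx.2)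
      have hsm : ∀ i, s i ∈ H ∧ s i ^ a = 1 := fun i => by
        have : s i ∈ closure (Set.range s) := subset_closure ⟨i, rfl⟩
        rw [hs] at this
        exact this
      have htm : ∀ i, t i ∈ H ∧ t i ^ b = 1 := fun i => by
        have : t i ∈ closure (Set.range t) := subset_closure ⟨i, rfl⟩
        rw [ht] at this
        exact this
      have hbez : (1 : ℤ) = a * Nat.gcdA a b + b * Nat.gcdB a b := by
        rw [← Nat.gcd_eq_gcd_ab, hab.gcd_eq_one]; rfl
      set u := Nat.gcdA a b
      set v := Nat.gcdB a b
      have e1 : ∀ x : B, x ^ a = 1 → x ^ (b * v : ℤ) = x := by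
        intro x hx
        have : (b * v : ℤ) = 1 - a * u := by linarith
        rw [this, zpow_sub, zpow_one, zpow_mul, zpow_natCast, hx]; simp
      have e2 : ∀ x : B, x ^ b = 1 → x ^ (a * u : ℤ) = x := by
        intro x hx
        have : (a * u : ℤ) = 1 - b * v := by linarith
        rw [this, zpow_sub, zpow_one, zpow_mul, zpow_natCast, hx]; simp
      refine ⟨fun i => s i * t i, le_antisymm ?_ ?_⟩
      · rw [closure_le]
        rintro _ ⟨i, rfl⟩
        exact H.mul_mem (hsm i).1 (htm i).1
      · set L := closure (Set.range fun i => s i * t i) with hL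
        have hi : ∀ i, s i * t i ∈ L := fun i => subset_closure ⟨i, rfl⟩
        have h1 : closure (Set.range s) ≤ L := by
          rw [closure_le]
          rintro _ ⟨i, rfl⟩
          have := L.zpow_mem (hi i) (b * v : ℤ)
          rw [mul_zpow, e1 _ (hsm i).2, zpow_mul (t i), zpow_natCast, (htm i).2] at this
          simpa using this
        have h2 : closure (Set.range t) ≤ L := by
          rw [closure_le]
          rintro _ ⟨i, rfl⟩
          have := L.zpow_mem (hi i) (a * u : ℤ)
          rw [mul_zpow, e2 _ (htm i).2, zpow_mul (s i), zpow_natCast, (hsm i).2] at this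
          simpa using this
        rw [hs] at h1
        rw [ht] at h2
        intro x hx
        have hxab := hH x hx
        have h3 : x = (x ^ a) ^ u * (x ^ b) ^ v := by
          rw [← zpow_natCast, ← zpow_natCast x b, ← zpow_mul, ← zpow_mul, ← zpow_add, ← hbez,
            zpow_one]
        rw [h3]
        refine L.mul_mem (L.zpow_mem (h2 ⟨H.pow_mem hx _, ?_⟩) _)
          (L.zpow_mem (h1 ⟨H.pow_mem hx _, ?_⟩) _)
        · show (x ^ a) ^ b = 1
          rw [← pow_mul]; exact hxab
        · show (x ^ b) ^ a = 1
          rw [← pow_mul, mul_comm]; exact hxab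
  exact key (Nat.card B) Nat.card_pos ⊤ (fun x _ => pow_card_eq_one')

lemma finite_thm {G : Type*} [Group G] [Finite G] {C : Subgroup G} {r : ℕ} (hC : C ≤ center G)
    (hr : RR C r) (H : Subgroup G) (hH : H ≤ ⁅(⊤ : Subgroup G), (⊤ : Subgroup G)⁆) :
    ∃ s : Fin (r + FF r) → G, closure (Set.range s) = H := by
  obtain ⟨s, hsH, hs⟩ := hr H (fg_of_fin H)
  letI : CommGroup (H ⊓ C : Subgroup G) := 
    { (inferInstance : Group (H ⊓ C : Subgroup G)) with
      mul_comm := fun a b => Subtype.ext (mem_center_iff.1 (hC b.2.2) a) }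
  obtain ⟨t, ht⟩ := ab_gen (B := (H ⊓ C : Subgroup G)) (k := FF r) (by
    intro p hp A hA
    haveI : Fact p.Prime := ⟨hp⟩
    rw [← card_map_of_injective (H ⊓ C).subtype_injective]
    refine sylow_bound hC hr ?_ ?_
    · rintro _ ⟨a, ha, rfl⟩
      rw [← map_pow, hA a ha, map_one]
    · rintro _ ⟨a, ha, rfl⟩
      exact ⟨a.2.2, hH a.2.1⟩)
  have ht' : closure (Set.range fun i => (t i : G)) = H ⊓ C := by
    have := congrArg (Subgroup.map (H ⊓ C).subtype) ht
    rw [MonoidHom.map_closure, ← Set.range_comp, ← MonoidHom.range_eq_map, range_subtype] at this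
    exact this
  refine ⟨Fin.append s (fun i => (t i : G)), le_antisymm ?_ ?_⟩
  · rw [closure_le]
    rintro _ ⟨i, rfl⟩
    refine Fin.addCases (fun i => ?_) (fun i => ?_) i
    · rw [Fin.append_left]; exact hsH i
    · rw [Fin.append_right]; exact (t i).2.1
  · set L := closure (Set.range (Fin.append s (fun i => (t i : G)))) with hL
    have h1 : closure (Set.range s) ≤ L := by
      refine closure_mono ?_
      rintro _ ⟨i, rfl⟩
      exact ⟨Fin.castAdd _ i, Fin.append_left _ _ _⟩
    have h2 : H ⊓ C ≤ L := by
      rw [← ht']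
      refine closure_mono ?_
      rintro _ ⟨i, rfl⟩
      exact ⟨Fin.natAdd _ i, Fin.append_right _ _ _⟩
    have h3 : closure (Set.range s) ≤ H := by
      rw [closure_le]
      rintro _ ⟨i, rfl⟩
      exact hsH i
    haveI := normal_of_le_center hC
    intro x hx
    obtain ⟨y, hy, c, hc, rfl⟩ := mem_sup_of_normal_right.1 (hs hx)
    refine L.mul_mem (h1 hy) (h2 ⟨?_, hc⟩)
    have := H.mul_mem (H.inv_mem (h3 hy)) hx
    simpa using this

end finite

section general

lemma fgab (D : Type*) [CommGroup D] [Group.FG D] :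
    ∃ T : Subgroup D, T.FiniteIndex ∧ ∀ x ∈ T, ∀ m : ℕ, 0 < m → x ^ m = 1 → x = 1 := by
  obtain ⟨ι, j, _, _, p, hp, e, ⟨φ⟩⟩ := CommGroup.equiv_free_prod_prod_multiplicative_zmod D
  haveI : ∀ i, NeZero (p i ^ e i) := fun i => ⟨pow_ne_zero _ (hp i).ne_zero⟩
  haveI : ∀ i, Finite (Multiplicative (ZMod (p i ^ e i))) := fun i =>
    inferInstanceAs (Finite (ZMod (p i ^ e i)))
  set n := Nat.card ((i : ι) → Multiplicative (ZMod (p i ^ e i))) with hn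
  have hn0 : 0 < n := Nat.card_pos
  refine ⟨(powMonoidHom n : D →* D).range, ?_, ?_⟩
  · have hfin : Finite (D ⧸ (powMonoidHom n : D →* D).range) := by
      apply CommGroup.finite_of_fg_isMulTorsion
      intro x
      obtain ⟨y, rfl⟩ := QuotientGroup.mk'_surjective _ x
      rw [isOfFinOrder_iff_pow_eq_one]
      refine ⟨n, hn0, ?_⟩
      rw [← map_pow]
      exact (QuotientGroup.eq_one_iff _).2 ⟨y, rfl⟩
    exact finiteIndex_of_finite_quotient
  · rintro _ ⟨y, rfl⟩ m hm h
    have h1 : y ^ (n * m) = 1 := by rw [pow_mul]; exact h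
    have h2 : (φ y) ^ (n * m) = 1 := by rw [← map_pow, h1, map_one]
    have h3 : (φ y).1 = 1 := by
      funext k
      have h4 : (φ y).1 k ^ (n * m) = 1 := by
        have := congrArg (fun z => z.1 k) h2
        simpa using this
      have h5 : ((n * m : ℕ)) • (Multiplicative.toAdd ((φ y).1 k)) = 0 := by
        rw [← toAdd_pow, h4]; rfl
      have h6 : Multiplicative.toAdd ((φ y).1 k) = 0 := by
        rcases smul_eq_zero.1 h5 with h7 | h7
        · exact absurd h7 (Nat.mul_pos hn0 hm).ne'
        · exact h7
      exact h6
    apply φ.injective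
    rw [map_one]
    show φ (y ^ n) = 1
    rw [map_pow]
    refine Prod.ext ?_ ?_
    · rw [Prod.pow_fst, h3, one_pow]; rfl
    · rw [Prod.pow_snd]; exact pow_card_eq_one'

lemma comm_mul_central {P : Type*} [Group P] {v c w d : P} (hc : c ∈ center P)
    (hd : d ∈ center P) : ⁅v * c, w * d⁆ = ⁅v, w⁆ := by
  have hcc := fun g => mem_center_iff.1 hc g
  have hdd := fun g => mem_center_iff.1 hd g
  rw [commutatorElement_def, commutatorElement_def]
  calc v * c * (w * d) * (v * c)⁻¹ * (w * d)⁻¹ 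
      = v * (c * (w * d)) * c⁻¹ * v⁻¹ * d⁻¹ * w⁻¹ := by group
    _ = v * w * (d * v⁻¹) * d⁻¹ * w⁻¹ := by rw [← hcc]; group
    _ = _ := by rw [← hdd]; group

lemma finite_comm {K : Type*} [Group K] {D : Subgroup K} (hD : D ≤ center K) [D.FiniteIndex] :
    Finite (commutator K) := by
  haveI : Finite (K ⧸ D) := inferInstance
  haveI : Finite (commutatorSet K) := by
    refine Set.Finite.subset (Set.finite_range
      (fun x : (K ⧸ D) × (K ⧸ D) => ⁅x.1.out, x.2.out⁆)) ?_
    rintro _ ⟨a, b, rfl⟩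
    refine ⟨((a : K ⧸ D), (b : K ⧸ D)), ?_⟩
    have key : ∀ g : K, ((g : K ⧸ D).out)⁻¹ * g ∈ center K := fun g =>
      hD (QuotientGroup.eq.1 (QuotientGroup.out_eq' (g : K ⧸ D)))
    have h := comm_mul_central (v := (a : K ⧸ D).out) (w := (b : K ⧸ D).out) (key a) (key b)
    rw [mul_inv_cancel_left, mul_inv_cancel_left] at h
    exact h.symm
  infer_instance

lemma fg_thm {K : Type*} [Group K] [Group.FG K] {D : Subgroup K} {r : ℕ} (hD : D ≤ center K)
    [D.FiniteIndex] (hr : RR D r) (H : Subgroup K)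
    (hH : H ≤ ⁅(⊤ : Subgroup K), (⊤ : Subgroup K)⁆) :
    ∃ s : Fin (r + FF r) → K, closure (Set.range s) = H := by
  haveI hfin : Finite (commutator K) := finite_comm hD
  letI : CommGroup D := { (inferInstance : Group D) with
    mul_comm := fun a b => Subtype.ext (mem_center_iff.1 (hD b.2) a) }
  obtain ⟨T0, hT0, hT0'⟩ := fgab D
  set T := T0.map D.subtype with hT
  have hTD : T ≤ D := map_subtype_le T0
  have hTc : T ≤ center K := hTD.trans hD
  haveI := normal_of_le_center hTc
  have hTi : T.FiniteIndex := by
    refine ⟨?_⟩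
    rw [← relIndex_mul_index hTD]
    refine mul_ne_zero ?_ FiniteIndex.index_ne_zero
    rw [relIndex, subgroupOf, hT, comap_map_eq_self_of_injective D.subtype_injective]
    exact hT0.index_ne_zero
  have hTK : ∀ x ∈ T, x ∈ ⁅(⊤ : Subgroup K), (⊤ : Subgroup K)⁆ → x = 1 := by
    rintro _ ⟨y, hy, rfl⟩ hx
    have h1 : (⟨D.subtype y, hx⟩ : commutator K) ^ (Nat.card (commutator K)) = 1 := pow_card_eq_one'
    have h2 : y ^ (Nat.card (commutator K)) = 1 := by
      apply Subtype.ext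
      have h3 := congrArg (fun z : commutator K => (z : K)) h1
      exact h3
    rw [hT0' y hy _ Nat.card_pos h2, map_one]
  haveI : Finite (K ⧸ T) := inferInstance
  set q := QuotientGroup.mk' T with hq
  have hqs : Function.Surjective q := QuotientGroup.mk'_surjective _
  obtain ⟨t, ht⟩ := finite_thm (map_le_center hD q hqs) (hr.map q hqs) (H.map q) (by
    refine (map_mono hH).trans ?_
    rw [map_commutator]
    exact commutator_mono le_top le_top)
  have ht' : ∀ i, ∃ x ∈ H, q x = t i := fun i => by
    have : t i ∈ closure (Set.range t) := subset_closure ⟨i, rfl⟩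
    rw [ht] at this
    exact this
  choose s hsH hs using ht'
  have hle : closure (Set.range s) ≤ H := by
    rw [closure_le]
    rintro _ ⟨i, rfl⟩
    exact hsH i
  refine ⟨s, le_antisymm hle ?_⟩
  intro x hx
  have h1 : (closure (Set.range s)).map q = H.map q := by
    rw [MonoidHom.map_closure, ← Set.range_comp, ← ht]
    congr 2
    funext i
    exact hs i
  have h2 : q x ∈ (closure (Set.range s)).map q := by rw [h1]; exact ⟨x, hx, rfl⟩
  obtain ⟨y, hy, hyx⟩ := h2
  have h3 : y⁻¹ * x ∈ T := QuotientGroup.eq.1 hyx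
  have h4 := hTK _ h3 (hH (H.mul_mem (H.inv_mem (hle hy)) hx))
  have : y = x := inv_mul_eq_one.1 h4
  rw [← this]; exact hy

lemma RR_center {G : Type*} [Group G] {r : ℕ} (h : HasRankLE (G ⧸ center G) r) :
    RR (center G) r := by
  classical
  intro H hH
  set q := QuotientGroup.mk' (center G) with hq
  obtain ⟨S, hS, hS'⟩ := h (H.map q) (fg_map hH q)
  have h1 : ∀ x : S, ∃ y ∈ H, q y = x := fun x => by
    have : (x : G ⧸ center G) ∈ closure (S : Set (G ⧸ center G)) := subset_closure x.2
    rw [hS'] at this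
    exact this
  choose l hlH hl using h1
  let s : Fin r → G := fun i => if hi : (i : ℕ) < S.card then l (S.equivFin.symm ⟨i, hi⟩) else 1
  refine ⟨s, fun i => ?_, ?_⟩
  · by_cases hi : (i : ℕ) < S.card
    · simp only [s, hi, dif_pos]; exact hlH _
    · simp only [s, hi, dif_neg, not_false_eq_true]; exact one_mem _
  · have h2 : H.map q ≤ (closure (Set.range s)).map q := by
      rw [← hS', closure_le]
      intro x hx
      refine ⟨l ⟨x, hx⟩, ?_, hl _⟩
      refine subset_closure ⟨⟨S.equivFin ⟨x, hx⟩, lt_of_lt_of_le (Fin.is_lt _) hS⟩, ?_⟩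
      simp [s]
    have h3 := map_le_iff_le_comap.1 h2
    rwa [comap_map_eq, hq, QuotientGroup.ker_mk'] at h3

lemma exists_fg {G : Type*} [Group G] (H : Subgroup G) (hH : H.FG)
    (hle : H ≤ ⁅(⊤ : Subgroup G), (⊤ : Subgroup G)⁆) : ∃ K : Subgroup G, K.FG ∧ H ≤ ⁅K, K⁆ := by
  classical
  have key : ∀ x ∈ commutator G, ∃ K : Subgroup G, K.FG ∧ x ∈ ⁅K, K⁆ := by
    intro x hx
    rw [commutator_eq_closure] at hx
    induction hx using closure_induction with
    | mem x hx =>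
      obtain ⟨a, b, rfl⟩ := hx
      refine ⟨closure {a, b}, ⟨{a, b}, by simp⟩, commutator_mem_commutator ?_ ?_⟩
      · exact subset_closure (by simp)
      · exact subset_closure (by simp)
    | one => exact ⟨⊥, ⟨∅, by simp⟩, one_mem _⟩
    | mul x y _ _ hx hy =>
      obtain ⟨K, hK, hxK⟩ := hx
      obtain ⟨L, hL, hyL⟩ := hy
      exact ⟨K ⊔ L, hK.sup hL, mul_mem (commutator_mono le_sup_left le_sup_left hxK)
        (commutator_mono le_sup_right le_sup_right hyL)⟩
    | inv x _ hx =>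
      obtain ⟨K, hK, hxK⟩ := hx
      exact ⟨K, hK, inv_mem hxK⟩
  obtain ⟨S, rfl⟩ := hH
  choose! f hf hf' using key
  refine ⟨S.sup f, FG.finset_sup S f fun x hx => hf x (hle (subset_closure hx)), ?_⟩
  rw [closure_le]
  intro x hx
  have : f x ≤ S.sup f := Finset.le_sup (f := f) hx
  exact commutator_mono this this (hf' x (hle (subset_closure hx)))

lemma general {G : Type*} [Group G] {r : ℕ} (h1 : IsLocallyFiniteGroup (G ⧸ center G))
    (h2 : HasRankLE (G ⧸ center G) r) (H : Subgroup G) (hH : H.FG)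
    (hle : H ≤ ⁅(⊤ : Subgroup G), (⊤ : Subgroup G)⁆) :
    Finite H ∧ ∃ s : Fin (r + FF r) → G, closure (Set.range s) = H := by
  obtain ⟨K, hK, hHK⟩ := exists_fg H hH hle
  haveI : Group.FG K := (Group.fg_iff_subgroup_fg K).2 hK
  have hr := (RR_center h2).subgroupOf le_rfl K
  have hc := subgroupOf_le_center (le_refl (center G)) K
  haveI : ((center G).subgroupOf K).FiniteIndex := by
    refine ⟨?_⟩
    have h3 := relIndex_ker (QuotientGroup.mk' (center G)) (K := K)
    rw [QuotientGroup.ker_mk'] at h3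
    show (center G).relIndex K ≠ 0
    rw [h3]
    haveI := h1 (K.map (QuotientGroup.mk' (center G))) (fg_map hK _)
    exact Nat.card_pos.ne'
  have hHK' : H ≤ K := hHK.trans (commutator_le_self K)
  have hm : (⁅(⊤ : Subgroup K), (⊤ : Subgroup K)⁆).map K.subtype = ⁅K, K⁆ := by
    rw [map_commutator, ← MonoidHom.range_eq_map, range_subtype]
  have hH' : H.subgroupOf K ≤ ⁅(⊤ : Subgroup K), (⊤ : Subgroup K)⁆ := by
    rw [← map_le_map_iff_of_injective K.subtype_injective, hm, subgroupOf_map_subtype,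
      inf_of_le_left hHK']
    exact hHK
  constructor
  · haveI : Finite (⁅(⊤ : Subgroup K), (⊤ : Subgroup K)⁆ : Subgroup K) := finite_comm hc
    haveI : Finite (H.subgroupOf K) := Finite.of_injective _ (inclusion_injective hH')
    exact Finite.of_equiv _ (subgroupOfEquivOfLe hHK').toEquiv
  · obtain ⟨s, hs⟩ := fg_thm hc hr (H.subgroupOf K) hH'
    refine ⟨fun i => (s i : G), ?_⟩
    have := congrArg (Subgroup.map K.subtype) hs
    rw [MonoidHom.map_closure, ← Set.range_comp, subgroupOf_map_subtype,
      inf_of_le_left hHK'] at this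
    exact this

end general

end RankBound

/-- If `G/Z(G)` is locally finite of finite rank `r`, then `G'` is
locally finite and the rank of `G'` is `r`-bounded. -/
theorem derived_locallyFinite_rank_bounded :
    ∃ f : ℕ → ℕ, ∀ (G : Type) [Group G], ∀ r : ℕ,
      IsLocallyFiniteGroup (G ⧸ Subgroup.center G) →
      HasRankLE (G ⧸ Subgroup.center G) r →
      IsLocallyFiniteGroup (commutator G) ∧ HasRankLE (commutator G) (f r) := by
  classical
  refine ⟨fun r => r + RankBound.FF r, ?_⟩
  intro G _ r h1 h2
  have key := fun (H : Subgroup (commutator G)) (hH : H.FG) =>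
    RankBound.general h1 h2 (H.map (commutator G).subtype) (RankBound.fg_map hH _)
      (Subgroup.map_subtype_le H)
  constructor
  · intro H hH
    haveI := (key H hH).1
    exact Finite.of_equiv _ (H.equivMapOfInjective _ (commutator G).subtype_injective).symm.toEquiv
  · intro H hH
    obtain ⟨s, hs⟩ := (key H hH).2
    have h3 : ∀ i, ∃ x : commutator G, (commutator G).subtype x = s i := fun i => by
      have : s i ∈ Subgroup.closure (Set.range s) := Subgroup.subset_closure ⟨i, rfl⟩
      rw [hs] at this
      obtain ⟨x, _, hx⟩ := this
      exact ⟨x, hx⟩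
    choose t ht using h3
    refine ⟨Finset.univ.image t, Finset.card_image_le.trans (by simp), ?_⟩
    apply Subgroup.map_injective (commutator G).subtype_injective
    rw [← hs, MonoidHom.map_closure, Finset.coe_image, Finset.coe_univ, Set.image_univ,
      ← Set.range_comp]
    congr 2
    funext i
    exact ht i
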